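/- There exist constants c₁, c₂ > 0 and a threshold M such that for every even integer m ≥ M, the number v*(2,m) of equivalence classes of centrally symmetric 2-dimensional convex lattice polytopes P with v(P) = m/2 is finite and satisfies exp(c₁·m^{1/3}) ≤ v*(2,m) ≤ exp(c₂·m^{1/3}). -/

import Mathlib

open MeasureTheory

noncomputable section

/-- The canonical embedding of integer vectors into real vectors. -/
def intVec {d : ℕ} (x : Fin d → ℤ) : Fin d → ℝ := fun i => (x i : ℝ)

/-- `P` is a convex lattice polytope: the convex hull of a finite set of lattice points. -/
def IsConvexLatticePolytope (d : ℕ) (P : Set (Fin d → ℝ)) : Prop :=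
  ∃ V : Finset (Fin d → ℤ), P = convexHull ℝ (intVec '' (V : Set (Fin d → ℤ)))

/-- `P` is `d`-dimensional: its affine span is all of `ℝ^d`. -/
def IsFullDim (d : ℕ) (P : Set (Fin d → ℝ)) : Prop :=
  affineSpan ℝ P = ⊤

/-- The set of lattice points of `P`. -/
def latticePts (d : ℕ) (P : Set (Fin d → ℝ)) : Set (Fin d → ℤ) :=
  {x | intVec x ∈ P}

/-- The lattice `ℤ^d` viewed inside `ℝ^d`. -/
def latticeSet (d : ℕ) : Set (Fin d → ℝ) := Set.range (intVec (d := d))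

/-- Two subsets of `ℝ^d` are lattice-equivalent if some affine bijection of `ℝ^d`
preserving `ℤ^d` maps one onto the other. -/
def LatticeEquiv (d : ℕ) (P₁ P₂ : Set (Fin d → ℝ)) : Prop :=
  ∃ σ : (Fin d → ℝ) ≃ᵃ[ℝ] (Fin d → ℝ), σ '' latticeSet d = latticeSet d ∧ P₂ = σ '' P₁

/-- The type of equivalence classes of `d`-dimensional convex lattice polytopes
satisfying the predicate `Q`, modulo lattice equivalence. -/
def ClassesType (d : ℕ) (Q : Set (Fin d → ℝ) → Prop) : Type :=
  Quot (fun P₁ P₂ : {P : Set (Fin d → ℝ) // IsConvexLatticePolytope d P ∧ IsFullDim d P ∧ Q P} =>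
    LatticeEquiv d P₁.1 P₂.1)

/-- `P` is centrally symmetric (with some center `c`, i.e. `P = 2c - P`). -/
def IsCentrallySymmetric (d : ℕ) (P : Set (Fin d → ℝ)) : Prop :=
  ∃ c : Fin d → ℝ, ∀ x, x ∈ P ↔ (2 : ℝ) • c - x ∈ P


lemma LatticeEquiv.rfl' {d : ℕ} (P : Set (Fin d → ℝ)) : LatticeEquiv d P P :=
  ⟨AffineEquiv.refl ℝ _, by simp, by simp⟩

lemma LatticeEquiv.symm' {d : ℕ} {P Q : Set (Fin d → ℝ)} (h : LatticeEquiv d P Q) :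
    LatticeEquiv d Q P := by
  obtain ⟨σ, h1, rfl⟩ := h
  refine ⟨σ.symm, ?_, ?_⟩
  · conv_lhs => rw [← h1]
    rw [← Set.image_comp]; simp
  · rw [← Set.image_comp]; simp

lemma LatticeEquiv.trans' {d : ℕ} {P Q R : Set (Fin d → ℝ)} (h : LatticeEquiv d P Q)
    (h' : LatticeEquiv d Q R) : LatticeEquiv d P R := by
  obtain ⟨σ, h1, rfl⟩ := h
  obtain ⟨τ, h2, rfl⟩ := h'
  refine ⟨σ.trans τ, ?_, ?_⟩
  · rw [AffineEquiv.coe_trans, Set.image_comp, h1, h2]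
  · rw [AffineEquiv.coe_trans, Set.image_comp]

lemma classes_eq_iff {d : ℕ} {Q : Set (Fin d → ℝ) → Prop}
    (P₁ P₂ : {P : Set (Fin d → ℝ) // IsConvexLatticePolytope d P ∧ IsFullDim d P ∧ Q P}) :
    ((Quot.mk _ P₁ : ClassesType d Q) = Quot.mk _ P₂) ↔ LatticeEquiv d P₁.1 P₂.1 := by
  have : Equivalence (fun P₁ P₂ : {P : Set (Fin d → ℝ) //
      IsConvexLatticePolytope d P ∧ IsFullDim d P ∧ Q P} => LatticeEquiv d P₁.1 P₂.1) :=
    ⟨fun _ => LatticeEquiv.rfl' _, fun h => h.symm', fun h h' => h.trans' h'⟩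
  exact this.quot_mk_eq_iff _ _

/-- The symmetric region between a function and its point reflection. -/
def LP (h : ℝ → ℝ) (k : ℕ) : Set (Fin 2 → ℝ) :=
  {p | -(k : ℝ) ≤ p 0 ∧ p 0 ≤ k ∧ -h (-p 0) ≤ p 1 ∧ p 1 ≤ h (p 0)}

lemma LP_symm (h : ℝ → ℝ) (k : ℕ) : IsCentrallySymmetric 2 (LP h k) := by
  refine ⟨0, fun x => ?_⟩
  simp only [LP, Set.mem_ofPred_eq, smul_zero, zero_sub, Pi.neg_apply, neg_neg, neg_le_neg_iff]
  constructor
  · rintro ⟨h1, h2, h3, h4⟩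
    exact ⟨by linarith, by linarith, by linarith, by linarith⟩
  · rintro ⟨h1, h2, h3, h4⟩
    exact ⟨by linarith, by linarith, by linarith, by linarith⟩

lemma LP_convex (h : ℝ → ℝ) (k : ℕ) (hc : ConcaveOn ℝ Set.univ h) : Convex ℝ (LP h k) := by
  rintro p ⟨p1, p2, p3, p4⟩ q ⟨q1, q2, q3, q4⟩ a b ha hb hab
  have e1 := hc.2 (Set.mem_univ (p 0)) (Set.mem_univ (q 0)) ha hb hab
  have e2 := hc.2 (Set.mem_univ (-p 0)) (Set.mem_univ (-q 0)) ha hb hab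
  simp only [smul_eq_mul] at e1 e2
  refine ⟨?_, ?_, ?_, ?_⟩
  · simp only [Pi.add_apply, Pi.smul_apply, smul_eq_mul]; nlinarith
  · simp only [Pi.add_apply, Pi.smul_apply, smul_eq_mul]; nlinarith
  · simp only [Pi.add_apply, Pi.smul_apply, smul_eq_mul]
    have : -(a * p 0 + b * q 0) = a * -p 0 + b * -q 0 := by ring
    rw [this]; nlinarith
  · simp only [Pi.add_apply, Pi.smul_apply, smul_eq_mul]; nlinarith

lemma mem_seg_of {C : Set (Fin 2 → ℝ)} (hC : Convex ℝ C) {x y1 y2 y : ℝ}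
    (h1 : ![x, y1] ∈ C) (h2 : ![x, y2] ∈ C) (l1 : y1 ≤ y) (l2 : y ≤ y2) : ![x, y] ∈ C := by
  rcases eq_or_lt_of_le (l1.trans l2) with e | e
  · have : y = y1 := le_antisymm (by linarith) l1
    rw [this]; exact h1
  · have hd : 0 < y2 - y1 := by linarith
    have := hC h1 h2 (a := (y2 - y) / (y2 - y1)) (b := (y - y1) / (y2 - y1))
      (div_nonneg (by linarith) hd.le) (div_nonneg (by linarith) hd.le) (by field_simp; ring)
    convert this using 1
    ext i; fin_cases i
    · simp; field_simp; ring
    · simp; field_simp; ring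

lemma LP_polytope (h : ℝ → ℝ) (k : ℕ) (hk : 0 < k) (hc : ConcaveOn ℝ Set.univ h) (H : ℤ → ℤ)
    (hH : ∀ j : ℤ, h j = H j)
    (hlin : ∀ (j : ℤ) (τ : ℝ), 0 ≤ τ → τ ≤ 1 → h (j + τ) = (1 - τ) * h j + τ * h (j + 1))
    (h0 : ∀ x : ℝ, x ≤ k → 0 ≤ h x) :
    IsConvexLatticePolytope 2 (LP h k) := by
  classical
  set V : Finset (Fin 2 → ℤ) := (Finset.Icc (-(k : ℤ)) k).image (fun j => ![j, H j]) ∪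
    (Finset.Icc (-(k : ℤ)) k).image (fun j => ![-j, -H j]) with hV
  refine ⟨V, ?_⟩
  have hC := convex_convexHull ℝ (intVec '' (V : Set (Fin 2 → ℤ)))
  have hup : ∀ j : ℤ, -(k : ℤ) ≤ j → j ≤ k →
      ![(j : ℝ), h j] ∈ convexHull ℝ (intVec '' (V : Set (Fin 2 → ℤ))) := by
    intro j h1 h2
    apply subset_convexHull
    refine ⟨![j, H j], ?_, ?_⟩
    · simp only [hV, Finset.coe_union, Finset.coe_image]
      exact Or.inl ⟨j, by simp [h1, h2], rfl⟩
    · ext i; fin_cases i <;> simp [intVec, hH]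
  have hlo : ∀ j : ℤ, -(k : ℤ) ≤ j → j ≤ k →
      ![-(j : ℝ), -h j] ∈ convexHull ℝ (intVec '' (V : Set (Fin 2 → ℤ))) := by
    intro j h1 h2
    apply subset_convexHull
    refine ⟨![-j, -H j], ?_, ?_⟩
    · simp only [hV, Finset.coe_union, Finset.coe_image]
      exact Or.inr ⟨j, by simp [h1, h2], rfl⟩
    · ext i; fin_cases i <;> simp [intVec, hH]
  have hdec : ∀ x : ℝ, -(k : ℝ) ≤ x → x ≤ k → ∃ (j : ℤ) (τ : ℝ), x = j + τ ∧ 0 ≤ τ ∧ τ ≤ 1 ∧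
      -(k : ℤ) ≤ j ∧ j + 1 ≤ k := by
    intro x h1 h2
    rcases eq_or_lt_of_le h2 with e | e
    · exact ⟨k - 1, 1, by push_cast; linarith, by norm_num, le_rfl, by omega, by omega⟩
    · refine ⟨⌊x⌋, Int.fract x, (Int.floor_add_fract x).symm, Int.fract_nonneg x,
        (Int.fract_lt_one x).le, ?_, ?_⟩
      · apply Int.le_floor.2; push_cast; exact h1
      · have : ⌊x⌋ < (k : ℤ) := Int.floor_lt.2 (by exact_mod_cast e)
        omega
  have hup' : ∀ x : ℝ, -(k : ℝ) ≤ x → x ≤ k →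
      ![x, h x] ∈ convexHull ℝ (intVec '' (V : Set (Fin 2 → ℤ))) := by
    intro x h1 h2
    obtain ⟨j, τ, rfl, t0, t1, j0, j1⟩ := hdec x h1 h2
    have := hC (hup j j0 (by omega)) (hup (j + 1) (by omega) j1) (a := 1 - τ) (b := τ)
      (by linarith) t0 (by ring)
    convert this using 1
    ext i; fin_cases i
    · simp; ring
    · simp [hlin j τ t0 t1]
  have hlo' : ∀ x : ℝ, -(k : ℝ) ≤ x → x ≤ k →
      ![-x, -h x] ∈ convexHull ℝ (intVec '' (V : Set (Fin 2 → ℤ))) := by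
    intro x h1 h2
    obtain ⟨j, τ, rfl, t0, t1, j0, j1⟩ := hdec x h1 h2
    have := hC (hlo j j0 (by omega)) (hlo (j + 1) (by omega) j1) (a := 1 - τ) (b := τ)
      (by linarith) t0 (by ring)
    convert this using 1
    ext i; fin_cases i
    · simp; ring
    · simp [hlin j τ t0 t1]; ring
  apply Set.Subset.antisymm
  · rintro p ⟨p1, p2, p3, p4⟩
    have e : p = ![p 0, p 1] := by ext i; fin_cases i <;> simp
    rw [e]
    have h1 := hup' (p 0) p1 p2
    have h2 := hlo' (-p 0) (by linarith) (by linarith)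
    rw [neg_neg] at h2
    exact mem_seg_of hC h2 h1 p3 p4
  · apply convexHull_min _ (LP_convex h k hc)
    rintro _ ⟨v, hv, rfl⟩
    simp only [hV, Finset.coe_union, Finset.coe_image] at hv
    rcases hv with ⟨j, hj, rfl⟩ | ⟨j, hj, rfl⟩
    · simp only [Finset.coe_Icc, Set.mem_Icc] at hj
      have j1 : -(k : ℝ) ≤ j := by exact_mod_cast hj.1
      have j2 : (j : ℝ) ≤ k := by exact_mod_cast hj.2
      have a1 := h0 (-(j : ℝ)) (by linarith)
      have a2 := h0 (j : ℝ) j2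
      have := hH j
      refine ⟨?_, ?_, ?_, ?_⟩ <;> simp [intVec] <;> linarith
    · simp only [Finset.coe_Icc, Set.mem_Icc] at hj
      have j1 : -(k : ℝ) ≤ j := by exact_mod_cast hj.1
      have j2 : (j : ℝ) ≤ k := by exact_mod_cast hj.2
      have a1 := h0 (-(j : ℝ)) (by linarith)
      have a2 := h0 (j : ℝ) j2
      have := hH j
      refine ⟨?_, ?_, ?_, ?_⟩ <;> simp [intVec] <;> linarith

lemma LP_volume (h : ℝ → ℝ) (k : ℕ) (hcont : Continuous h)
    (h0 : ∀ x : ℝ, x ≤ k → 0 ≤ h x) :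
    volume (LP h k) = ENNReal.ofReal (2 * ∫ x in (-(k : ℝ))..k, h x) := by
  have hkk : -(k : ℝ) ≤ k := by have : (0 : ℝ) ≤ k := by positivity
                                linarith
  set S : Set (ℝ × ℝ) := {p | -(k : ℝ) ≤ p.1 ∧ p.1 ≤ k ∧ -h (-p.1) ≤ p.2 ∧ p.2 ≤ h p.1} with hS
  have hSc : IsClosed S := by
    have c1 : IsClosed {p : ℝ × ℝ | -(k : ℝ) ≤ p.1} := isClosed_le (by fun_prop) (by fun_prop)
    have c2 : IsClosed {p : ℝ × ℝ | p.1 ≤ (k : ℝ)} := isClosed_le (by fun_prop) (by fun_prop)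
    have c3 : IsClosed {p : ℝ × ℝ | -h (-p.1) ≤ p.2} := isClosed_le (by fun_prop) (by fun_prop)
    have c4 : IsClosed {p : ℝ × ℝ | p.2 ≤ h p.1} := isClosed_le (by fun_prop) (by fun_prop)
    exact c1.inter (c2.inter (c3.inter c4))
  have e1 : volume (LP h k) = volume S := by
    rw [← (volume_preserving_finTwoArrow ℝ).measure_preimage hSc.measurableSet.nullMeasurableSet]
    rfl
  rw [e1, Measure.volume_eq_prod, Measure.prod_apply hSc.measurableSet]
  have e2 : ∀ x : ℝ, volume (Prod.mk x ⁻¹' S) =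
      (Set.Icc (-(k : ℝ)) k).indicator (fun x => ENNReal.ofReal (h x + h (-x))) x := by
    intro x
    by_cases hx : x ∈ Set.Icc (-(k : ℝ)) k
    · rw [Set.indicator_of_mem hx]
      have : Prod.mk x ⁻¹' S = Set.Icc (-h (-x)) (h x) := by
        ext y; simp only [hS, Set.mem_preimage, Set.mem_ofPred_eq, Set.mem_Icc]
        exact ⟨fun h => h.2.2, fun h => ⟨hx.1, hx.2, h⟩⟩
      rw [this, Real.volume_Icc]; congr 1; ring
    · rw [Set.indicator_of_notMem hx]
      have : Prod.mk x ⁻¹' S = ∅ := by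
        ext y; simp only [hS, Set.mem_preimage, Set.mem_ofPred_eq, Set.mem_empty_iff_false,
          iff_false]
        exact fun h => hx ⟨h.1, h.2.1⟩
      rw [this, measure_empty]
  simp_rw [e2]
  rw [lintegral_indicator measurableSet_Icc]
  have hI : Continuous (fun x => h x + h (-x)) := by fun_prop
  rw [← ofReal_integral_eq_lintegral_ofReal (hI.integrableOn_Icc)
    ((ae_restrict_iff' measurableSet_Icc).2 (Filter.Eventually.of_forall (fun x hx =>
      add_nonneg (h0 x hx.2) (h0 (-x) (by linarith [hx.1])))))]
  congr 1
  rw [integral_Icc_eq_integral_Ioc, ← intervalIntegral.integral_of_le hkk,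
    intervalIntegral.integral_add (hcont.intervalIntegrable _ _)
      ((by fun_prop : Continuous (fun x => h (-x))).intervalIntegrable _ _),
    intervalIntegral.integral_comp_neg]
  simp; ring

lemma fullDim_of_volume {P : Set (Fin 2 → ℝ)} (h : volume P ≠ 0) : IsFullDim 2 P := by
  by_contra hne
  apply h
  have := Measure.addHaar_affineSubspace (volume : Measure (Fin 2 → ℝ)) (affineSpan ℝ P) hne
  exact measure_mono_null (subset_affineSpan ℝ P) this

/-- A concave piecewise linear function with integer breakpoints and integer slopes. -/
def hw (k B : ℕ) (w : ℕ → ℕ) (x : ℝ) : ℝ :=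
  B - ∑ i ∈ Finset.range k, (w i : ℝ) * max 0 (x - (k - i))

lemma hw_cont (k B : ℕ) (w : ℕ → ℕ) : Continuous (hw k B w) := by
  unfold hw; fun_prop

lemma hw_concave (k B : ℕ) (w : ℕ → ℕ) : ConcaveOn ℝ Set.univ (hw k B w) := by
  refine ⟨convex_univ, fun x _ y _ a b ha hb hab => ?_⟩
  simp only [hw, smul_eq_mul]
  have : ∑ i ∈ Finset.range k, (w i : ℝ) * max 0 (a * x + b * y - (k - i)) ≤
      a * ∑ i ∈ Finset.range k, (w i : ℝ) * max 0 (x - (k - i)) +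
      b * ∑ i ∈ Finset.range k, (w i : ℝ) * max 0 (y - (k - i)) := by
    rw [Finset.mul_sum, Finset.mul_sum, ← Finset.sum_add_distrib]
    apply Finset.sum_le_sum
    intro i _
    have hwi : (0 : ℝ) ≤ w i := by positivity
    have : max 0 (a * x + b * y - ((k : ℝ) - i)) ≤
        a * max 0 (x - (k - i)) + b * max 0 (y - (k - i)) := by
      have m1 := le_max_left 0 (x - ((k : ℝ) - i))
      have m2 := le_max_right 0 (x - ((k : ℝ) - i))
      have m3 := le_max_left 0 (y - ((k : ℝ) - i))
      have m4 := le_max_right 0 (y - ((k : ℝ) - i))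
      apply max_le
      · positivity
      · have : a * x + b * y - ((k : ℝ) - i) = a * (x - (k - i)) + b * (y - (k - i)) := by
          linear_combination (-(k : ℝ) + i) * (-hab)
        rw [this]
        gcongr
    calc _ ≤ (w i : ℝ) * (a * max 0 (x - (k - i)) + b * max 0 (y - (k - i))) := by gcongr
      _ = _ := by ring
  have : a * (B : ℝ) + b * B = B := by rw [← add_mul, hab, one_mul]
  nlinarith

lemma hw_int (k B : ℕ) (w : ℕ → ℕ) (j : ℤ) : hw k B w j =
    ((B - ∑ i ∈ Finset.range k, (w i : ℤ) * max 0 (j - (k - i)) : ℤ) : ℝ) := by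
  simp [hw]

lemma max_lin (z : ℤ) (τ : ℝ) (h0 : 0 ≤ τ) (h1 : τ ≤ 1) :
    max 0 ((z : ℝ) + τ) = (1 - τ) * max 0 (z : ℝ) + τ * max 0 ((z : ℝ) + 1) := by
  rcases le_or_gt 0 z with h | h
  · have : (0 : ℝ) ≤ z := by exact_mod_cast h
    rw [max_eq_right (by linarith), max_eq_right (by linarith), max_eq_right (by linarith)]; ring
  · have : (z : ℝ) + 1 ≤ 0 := by exact_mod_cast h
    rw [max_eq_left (by linarith), max_eq_left (by linarith), max_eq_left (by linarith)]; ring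

lemma hw_lin (k B : ℕ) (w : ℕ → ℕ) (j : ℤ) (τ : ℝ) (h0 : 0 ≤ τ) (h1 : τ ≤ 1) :
    hw k B w (j + τ) = (1 - τ) * hw k B w j + τ * hw k B w (j + 1) := by
  simp only [hw]
  have : ∑ i ∈ Finset.range k, (w i : ℝ) * max 0 ((j : ℝ) + τ - (k - i)) =
      (1 - τ) * ∑ i ∈ Finset.range k, (w i : ℝ) * max 0 ((j : ℝ) - (k - i)) +
      τ * ∑ i ∈ Finset.range k, (w i : ℝ) * max 0 ((j : ℝ) + 1 - (k - i)) := by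
    rw [Finset.mul_sum, Finset.mul_sum, ← Finset.sum_add_distrib]
    apply Finset.sum_congr rfl
    intro i _
    have := max_lin (j - (k - i)) τ h0 h1
    push_cast at this
    rw [show (j : ℝ) + τ - (k - i) = (j : ℝ) - (k - i) + τ by ring, this,
      show (j : ℝ) + 1 - (k - i) = (j : ℝ) - (k - i) + 1 by ring]
    ring
  rw [this]; ring

lemma hw_ge (k B : ℕ) (w : ℕ → ℕ) (x : ℝ) (hx : x ≤ k) :
    (B : ℝ) - ∑ i ∈ Finset.range k, (w i : ℝ) * i ≤ hw k B w x := by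
  unfold hw
  apply sub_le_sub_left
  apply Finset.sum_le_sum
  intro i _
  apply mul_le_mul_of_nonneg_left _ (by positivity)
  apply max_le (by positivity); linarith

lemma hw_le (k B : ℕ) (w : ℕ → ℕ) (x : ℝ) : hw k B w x ≤ B := by
  unfold hw
  have : 0 ≤ ∑ i ∈ Finset.range k, (w i : ℝ) * max 0 (x - (k - i)) :=
    Finset.sum_nonneg (fun i _ => mul_nonneg (by positivity) (le_max_left _ _))
  linarith

lemma int_max (k i : ℝ) (h0 : 0 ≤ i) (h : i ≤ k) :
    ∫ x in (-k)..k, max 0 (x - (k - i)) = i ^ 2 / 2 := by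
  have hi : ∀ a b : ℝ, IntervalIntegrable (fun x : ℝ => max 0 (x - (k - i))) volume a b :=
    fun a b => (by fun_prop : Continuous (fun x : ℝ => max 0 (x - (k - i)))).intervalIntegrable a b
  rw [← intervalIntegral.integral_add_adjacent_intervals (hi (-k) (k - i)) (hi (k - i) k)]
  have e1 : ∫ x in (-k)..(k - i), max 0 (x - (k - i)) = ∫ x in (-k)..(k - i), (0 : ℝ) := by
    apply intervalIntegral.integral_congr
    intro x hx
    rw [Set.uIcc_of_le (by linarith)] at hx
    exact max_eq_left (by linarith [hx.2])
  have e2 : ∫ x in (k - i)..k, max 0 (x - (k - i)) = ∫ x in (k - i)..k, (x - (k - i)) := by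
    apply intervalIntegral.integral_congr
    intro x hx
    rw [Set.uIcc_of_le (by linarith)] at hx
    exact max_eq_right (by linarith [hx.1])
  rw [e1, e2]
  simp [intervalIntegral.integral_sub, integral_id]
  ring

lemma hw_integral (k B : ℕ) (w : ℕ → ℕ) : 2 * ∫ x in (-(k : ℝ))..k, hw k B w x =
    4 * k * B - ∑ i ∈ Finset.range k, (w i : ℝ) * i ^ 2 := by
  unfold hw
  rw [intervalIntegral.integral_sub, intervalIntegral.integral_finsetSum]
  · have : ∀ i ∈ Finset.range k, ∫ x in (-(k : ℝ))..k, (w i : ℝ) * max 0 (x - (k - i)) =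
        (w i : ℝ) * (i ^ 2 / 2) := by
      intro i hi
      rw [intervalIntegral.integral_const_mul, int_max]
      · positivity
      · exact_mod_cast (Finset.mem_range.1 hi).le
    rw [Finset.sum_congr rfl this, mul_sub, Finset.mul_sum]
    simp
    congr 1
    · ring
    · apply Finset.sum_congr rfl; intros; ring
  · intro i _
    exact (by fun_prop : Continuous _).intervalIntegrable _ _
  · exact intervalIntegrable_const
  · exact (by fun_prop : Continuous _).intervalIntegrable _ _

lemma hw_second (k B : ℕ) (w : ℕ → ℕ) (j : ℕ) (hj : j < k) :
    hw k B w ((k : ℝ) - j - 1) - 2 * hw k B w ((k : ℝ) - j) + hw k B w ((k : ℝ) - j + 1) =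
      - (w j : ℝ) := by
  have key : ∀ i : ℕ, max 0 ((k : ℝ) - j - 1 - (k - i)) - 2 * max 0 ((k : ℝ) - j - (k - i)) +
      max 0 ((k : ℝ) - j + 1 - (k - i)) = if i = j then 1 else 0 := by
    intro i
    rcases lt_trichotomy i j with h | h | h
    · have : (i : ℝ) + 1 ≤ j := by exact_mod_cast h
      rw [if_neg h.ne, max_eq_left (by linarith), max_eq_left (by linarith),
        max_eq_left (by linarith)]; ring
    · subst h
      rw [if_pos rfl, max_eq_left (by linarith), max_eq_left (by linarith),
        max_eq_right (by linarith)]; ring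
    · have : (j : ℝ) + 1 ≤ i := by exact_mod_cast h
      rw [if_neg h.ne', max_eq_right (by linarith), max_eq_right (by linarith),
        max_eq_right (by linarith)]; ring
  have e : (w j : ℝ) = ∑ i ∈ Finset.range k, (w i : ℝ) * (if i = j then 1 else 0) := by
    simp [hj]
  rw [e]
  simp_rw [← key]
  unfold hw
  have : ∀ a b c d : ℝ, (d - a) - 2 * (d - b) + (d - c) = -(a - 2 * b + c) := by intros; ring
  rw [this, Finset.mul_sum, ← Finset.sum_sub_distrib, ← Finset.sum_add_distrib]
  congr 1
  apply Finset.sum_congr rfl; intros; ring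

lemma LP_inj {h h' : ℝ → ℝ} {k : ℕ} (h0 : ∀ x : ℝ, x ≤ k → 0 ≤ h x)
    (h0' : ∀ x : ℝ, x ≤ k → 0 ≤ h' x) (e : LP h k = LP h' k) (x : ℝ) (h1 : -(k : ℝ) ≤ x)
    (h2 : x ≤ k) : h x = h' x := by
  have m1 : ![x, h x] ∈ LP h k := by
    refine ⟨h1, h2, ?_, le_rfl⟩
    have := h0 x h2
    have := h0 (-x) (by linarith)
    simp; linarith
  have m2 : ![x, h' x] ∈ LP h' k := by
    refine ⟨h1, h2, ?_, le_rfl⟩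
    have := h0' x h2
    have := h0' (-x) (by linarith)
    simp; linarith
  rw [e] at m1
  rw [← e] at m2
  exact le_antisymm (by simpa using m1.2.2.2) (by simpa using m2.2.2.2)

lemma hw_LP_inj {k B B' : ℕ} {w w' : ℕ → ℕ} (h0 : ∀ x : ℝ, x ≤ k → 0 ≤ hw k B w x)
    (h0' : ∀ x : ℝ, x ≤ k → 0 ≤ hw k B' w' x) (e : LP (hw k B w) k = LP (hw k B' w') k)
    (j : ℕ) (j1 : 1 ≤ j) (hj : j < k) : w j = w' j := by
  have a1 := hw_second k B w j hj
  have a2 := hw_second k B' w' j hj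
  have c1 : (1 : ℝ) ≤ j := by exact_mod_cast j1
  have c2 : (j : ℝ) + 1 ≤ k := by exact_mod_cast hj
  rw [LP_inj h0 h0' e _ (by linarith) (by linarith), LP_inj h0 h0' e _ (by linarith) (by linarith),
    LP_inj h0 h0' e _ (by linarith) (by linarith), a2] at a1
  have : (w' j : ℝ) = w j := by linarith
  exact_mod_cast this.symm

/-- Three affinely independent lattice points. -/
def tri : Fin 3 → Fin 2 → ℤ := ![![0, 0], ![1, 0], ![0, 1]]

lemma affine_formula (σ : (Fin 2 → ℝ) ≃ᵃ[ℝ] (Fin 2 → ℝ)) (x : Fin 2 → ℝ) :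
    σ x = x 0 • (σ (intVec (tri 1)) - σ (intVec (tri 0))) +
      x 1 • (σ (intVec (tri 2)) - σ (intVec (tri 0))) + σ (intVec (tri 0)) := by
  have h0 : intVec (tri 0) = 0 := by ext i; fin_cases i <;> simp [intVec, tri]
  have key : ∀ y, σ y = σ.linear y + σ 0 := by
    intro y
    have := σ.map_vadd 0 y
    simpa using this
  rw [h0, key x, key (intVec (tri 1)), key (intVec (tri 2))]
  have hx : x = x 0 • intVec (tri 1) + x 1 • intVec (tri 2) := by
    ext i; fin_cases i <;> simp [intVec, tri]
  conv_lhs => rw [hx]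
  simp

lemma mult_bound {ι : Type} [DecidableEq ι] (Q : Set (Fin 2 → ℝ) → Prop)
    (hfin : Finite (ClassesType 2 Q)) (𝒯 : Finset ι) (n : ℕ)
    (f : ι → {P : Set (Fin 2 → ℝ) // IsConvexLatticePolytope 2 P ∧ IsFullDim 2 P ∧ Q P})
    (hinj : ∀ T ∈ 𝒯, ∀ T' ∈ 𝒯, (f T).1 = (f T').1 → T = T')
    (hbox : ∀ T ∈ 𝒯, ∀ p ∈ (f T).1, ∀ i, |p i| ≤ n)
    (htri : ∀ T ∈ 𝒯, ∀ i, intVec (tri i) ∈ (f T).1) :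
    𝒯.card ≤ (2 * n + 1) ^ 6 * Nat.card (ClassesType 2 Q) := by
  classical
  haveI := Fintype.ofFinite (ClassesType 2 Q)
  set g : ι → ClassesType 2 Q := fun T => Quot.mk _ (f T) with hg
  have h1 : 𝒯.card ≤ (2 * n + 1) ^ 6 * (𝒯.image g).card := by
    apply Finset.card_le_mul_card_image
    intro a ha
    obtain ⟨T0, hT0, rfl⟩ := Finset.mem_image.1 ha
    have hex : ∀ T ∈ 𝒯.filter (fun x => g x = g T0), ∃ (σ : (Fin 2 → ℝ) ≃ᵃ[ℝ] (Fin 2 → ℝ))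
        (z : Fin 3 → Fin 2 → ℤ), (f T).1 = σ '' (f T0).1 ∧
        ∀ i, σ (intVec (tri i)) = intVec (z i) := by
      intro T hT
      have := (classes_eq_iff _ _).1 (Finset.mem_filter.1 hT).2.symm
      obtain ⟨σ, h1, h2⟩ := this
      have : ∀ i, ∃ z : Fin 2 → ℤ, σ (intVec (tri i)) = intVec z := by
        intro i
        have : σ (intVec (tri i)) ∈ latticeSet 2 := by
          rw [← h1]; exact ⟨_, ⟨_, rfl⟩, rfl⟩
        obtain ⟨z, hz⟩ := this
        exact ⟨z, hz.symm⟩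
      choose z hz using this
      exact ⟨σ, z, h2, hz⟩
    choose! σ z h1 h2 using hex
    have hcard : (Fintype.piFinset (fun _ : Fin 3 => Fintype.piFinset (fun _ : Fin 2 =>
        Finset.Icc (-(n : ℤ)) n))).card = (2 * n + 1) ^ 6 := by
      simp [Fintype.card_piFinset]
      rw [← pow_mul]
      congr 1; omega
    rw [← hcard]
    apply Finset.card_le_card_of_injOn z
    · intro T hT
      have hT' := (Finset.mem_filter.1 hT).1
      simp only [Finset.mem_coe, Fintype.mem_piFinset, Finset.mem_Icc]
      intro i j
      have hm : intVec (z T i) ∈ (f T).1 := by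
        rw [← h2 T hT, h1 T hT]
        exact ⟨_, htri T0 hT0 i, rfl⟩
      have := hbox T hT' _ hm j
      simp only [intVec] at this
      rw [abs_le] at this
      exact ⟨by exact_mod_cast this.1, by exact_mod_cast this.2⟩
    · intro T hT T' hT' e
      apply hinj T (Finset.mem_filter.1 hT).1 T' (Finset.mem_filter.1 hT').1
      rw [h1 T hT, h1 T' hT']
      apply Set.image_congr
      intro x _
      rw [affine_formula (σ T), affine_formula (σ T')]
      simp only [h2 T hT, h2 T' hT', e]
  have h2 : (𝒯.image g).card ≤ Nat.card (ClassesType 2 Q) := by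
    rw [Nat.card_eq_fintype_card]; exact Finset.card_le_univ _
  exact h1.trans (Nat.mul_le_mul_left _ h2)

lemma family_exists (n k : ℕ) (hk : 3 ≤ k) (hn : 100 * k ^ 3 ≤ n) (T : Finset ℕ)
    (hT : T ⊆ Finset.Icc 2 (k - 1)) :
    ∃ (B : ℕ) (w : ℕ → ℕ), (∀ x : ℝ, x ≤ k → 1 ≤ hw k B w x) ∧ B ≤ n ∧
      (∀ j, 2 ≤ j → j < k → w j = if j ∈ T then 1 else 0) ∧
      (4 * k * B - ∑ i ∈ Finset.range k, (w i : ℝ) * i ^ 2 : ℝ) = n := by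
  classical
  set ρ := ∑ i ∈ T, i ^ 2 with hρ
  have hTk : ∀ i ∈ T, 2 ≤ i ∧ i < k := by
    intro i hi
    have := Finset.mem_Icc.1 (hT hi)
    omega
  have hTc : T.card ≤ k := by
    have := Finset.card_le_card hT
    simp at this; omega
  have hρk : ρ ≤ k ^ 3 := by
    calc ρ ≤ T.card • k ^ 2 := Finset.sum_le_card_nsmul _ _ _ (fun i hi =>
          Nat.pow_le_pow_left (hTk i hi).2.le 2)
      _ ≤ k * k ^ 2 := by rw [smul_eq_mul]; exact Nat.mul_le_mul_right _ hTc
      _ = k ^ 3 := by ring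
  have hσk : ∑ i ∈ T, i ≤ k ^ 2 := by
    calc ∑ i ∈ T, i ≤ T.card • k := Finset.sum_le_card_nsmul _ _ _ (fun i hi => (hTk i hi).2.le)
      _ ≤ k * k := by rw [smul_eq_mul]; exact Nat.mul_le_mul_right _ hTc
      _ = k ^ 2 := by ring
  obtain ⟨B, t, hBt, ht⟩ : ∃ B t : ℕ, 4 * k * B = n + ρ + t ∧ t < 4 * k := by
    refine ⟨(n + ρ + (4 * k - 1)) / (4 * k), 4 * k - 1 - (n + ρ + (4 * k - 1)) % (4 * k), ?_, ?_⟩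
    · have h1 := Nat.div_add_mod (n + ρ + (4 * k - 1)) (4 * k)
      have h2 := Nat.mod_lt (n + ρ + (4 * k - 1)) (show 4 * k > 0 by omega)
      set X := 4 * k * ((n + ρ + (4 * k - 1)) / (4 * k))
      omega
    · omega
  have hk2 : 3 * k ≤ k ^ 2 := by nlinarith
  have hk3 : 3 * k ^ 2 ≤ k ^ 3 := by nlinarith [sq_nonneg k]
  have hB1 : B ≤ n := by
    have : 4 * k * B ≤ 4 * k * n := by
      rw [hBt]; nlinarith
    exact Nat.le_of_mul_le_mul_left this (by omega)
  have hB2 : 25 * k ^ 2 ≤ B := by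
    have : 4 * k * (25 * k ^ 2) ≤ 4 * k * B := by
      rw [hBt]; nlinarith
    exact Nat.le_of_mul_le_mul_left this (by omega)
  set w : ℕ → ℕ := fun i => (if i = 1 then t else 0) + (if i ∈ T then 1 else 0) with hw'
  have hsum : ∀ F : ℕ → ℕ, ∑ i ∈ Finset.range k, w i * F i = t * F 1 + ∑ i ∈ T, F i := by
    intro F
    simp only [hw', add_mul, Finset.sum_add_distrib, ite_mul, zero_mul, one_mul]
    congr 1
    · rw [Finset.sum_ite_eq']; simp; omega
    · rw [← Finset.sum_filter]
      congr 1
      ext i; simp only [Finset.mem_filter, Finset.mem_range]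
      exact ⟨fun h => h.2, fun h => ⟨(hTk i h).2, h⟩⟩
  refine ⟨B, w, ?_, hB1, ?_, ?_⟩
  · intro x hx
    refine le_trans ?_ (hw_ge k B w x hx)
    have h1 := hsum (fun i => i)
    have h2 : (1 + ∑ i ∈ Finset.range k, w i * i) ≤ B := by
      rw [h1]; omega
    have h3 : ((1 + ∑ i ∈ Finset.range k, w i * i : ℕ) : ℝ) ≤ B := by exact_mod_cast h2
    push_cast at h3
    linarith
  · intro j h2 _
    simp only [hw']
    rw [if_neg (by omega), zero_add]
  · have h1 := hsum (fun i => i ^ 2)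
    have h3 : 4 * k * B = n + ∑ i ∈ Finset.range k, w i * i ^ 2 := by
      rw [h1, hBt, hρ]; ring
    have h4 : (4 * k * B : ℝ) = n + ∑ i ∈ Finset.range k, (w i : ℝ) * (i : ℝ) ^ 2 := by
      exact_mod_cast h3
    linarith

lemma lower_count (n k m : ℕ) (hm : m = 2 * n) (hk : 3 ≤ k) (hn : 100 * k ^ 3 ≤ n)
    (hfin : Finite (ClassesType 2 (fun P => IsCentrallySymmetric 2 P ∧
        volume P = ENNReal.ofReal ((m : ℝ) / 2)))) :
    2 ^ (k - 2) ≤ (2 * n + 1) ^ 6 * Nat.card (ClassesType 2 (fun P => IsCentrallySymmetric 2 P ∧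
        volume P = ENNReal.ofReal ((m : ℝ) / 2))) := by
  classical
  have hex := family_exists n k hk hn
  choose! B w h1 h2 h3 h4 using hex
  set 𝒯 := (Finset.Icc 2 (k - 1)).powerset with h𝒯
  have hn0 : 0 < n := by have : 0 < k ^ 3 := by positivity
                         omega
  have hkn : k ≤ n := by nlinarith [sq_nonneg k, Nat.pow_le_pow_right (show 0 < k by omega) (show 1 ≤ 3 by norm_num)]
  have hcard : 𝒯.card = 2 ^ (k - 2) := by
    rw [h𝒯, Finset.card_powerset, Nat.card_Icc]; congr 1
  have hprop : ∀ T ∈ 𝒯, IsConvexLatticePolytope 2 (LP (hw k (B T) (w T)) k) ∧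
      IsFullDim 2 (LP (hw k (B T) (w T)) k) ∧ IsCentrallySymmetric 2 (LP (hw k (B T) (w T)) k) ∧
      volume (LP (hw k (B T) (w T)) k) = ENNReal.ofReal ((m : ℝ) / 2) := by
    intro T hT
    have hT := Finset.mem_powerset.1 hT
    have hpos : ∀ x : ℝ, x ≤ k → 0 ≤ hw k (B T) (w T) x := fun x hx => by
      linarith [h1 T hT x hx]
    have hv : volume (LP (hw k (B T) (w T)) k) = ENNReal.ofReal ((m : ℝ) / 2) := by
      rw [LP_volume _ _ (hw_cont _ _ _) hpos, hw_integral, h4 T hT, hm]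
      push_cast; congr 1; ring
    refine ⟨?_, ?_, LP_symm _ _, hv⟩
    · exact LP_polytope _ _ (by omega) (hw_concave _ _ _) _ (hw_int k (B T) (w T))
        (hw_lin k (B T) (w T)) hpos
    · apply fullDim_of_volume
      rw [hv]
      have : (0 : ℝ) < m / 2 := by rw [hm]; push_cast; positivity
      simpa using this
  have hne : (∅ : Finset ℕ) ∈ 𝒯 := by simp [h𝒯]
  set f : Finset ℕ → {P : Set (Fin 2 → ℝ) // IsConvexLatticePolytope 2 P ∧ IsFullDim 2 P ∧
      (IsCentrallySymmetric 2 P ∧ volume P = ENNReal.ofReal ((m : ℝ) / 2))} :=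
    fun T => if hT : T ∈ 𝒯 then ⟨_, hprop T hT⟩ else ⟨_, hprop ∅ hne⟩ with hf
  have hfT : ∀ T ∈ 𝒯, (f T).1 = LP (hw k (B T) (w T)) k := by
    intro T hT
    simp only [hf, dif_pos hT]
  rw [← hcard]
  apply mult_bound _ hfin 𝒯 n f
  · intro T hT T' hT' e
    rw [hfT T hT, hfT T' hT'] at e
    have hT := Finset.mem_powerset.1 hT
    have hT' := Finset.mem_powerset.1 hT'
    have := hw_LP_inj (fun x hx => by linarith [h1 T hT x hx])
      (fun x hx => by linarith [h1 T' hT' x hx]) e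
    ext j
    by_cases hj : 2 ≤ j ∧ j < k
    · have e := this j (by omega) hj.2
      rw [h3 T hT j hj.1 hj.2, h3 T' hT' j hj.1 hj.2] at e
      by_cases a1 : j ∈ T <;> by_cases a2 : j ∈ T' <;> simp_all
    · have a1 : j ∉ T := fun h => hj (by have := Finset.mem_Icc.1 (hT h); omega)
      have a2 : j ∉ T' := fun h => hj (by have := Finset.mem_Icc.1 (hT' h); omega)
      simp [a1, a2]
  · intro T hT p hp i
    rw [hfT T hT] at hp
    have hT := Finset.mem_powerset.1 hT
    have hkn' : (k : ℝ) ≤ n := by exact_mod_cast hkn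
    have hBn : (B T : ℝ) ≤ n := by exact_mod_cast h2 T hT
    obtain ⟨p1, p2, p3, p4⟩ := hp
    have b1 := hw_le k (B T) (w T) (p 0)
    have b2 := hw_le k (B T) (w T) (-p 0)
    fin_cases i
    · simp only [Fin.zero_eta]; rw [abs_le]; constructor <;> linarith
    · simp only [Fin.mk_one]; rw [abs_le]; constructor <;> linarith
  · intro T hT i
    rw [hfT T hT]
    have hT := Finset.mem_powerset.1 hT
    have hk' : (3 : ℝ) ≤ k := by exact_mod_cast hk
    have c0 := h1 T hT 0 (by linarith)
    have c1 := h1 T hT 1 (by linarith)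
    have c2 := h1 T hT (-1) (by linarith)
    fin_cases i <;> refine ⟨?_, ?_, ?_, ?_⟩ <;> simp [tri, intVec] <;> linarith

/-- Planar determinant. -/
def det2 (d e : Fin 2 → ℤ) : ℤ := d 0 * e 1 - d 1 * e 0

/-- Lexicographically positive vectors. -/
def LPos (d : Fin 2 → ℤ) : Prop := 0 < d 0 ∨ (d 0 = 0 ∧ 0 < d 1)

/-- Vertices of the lattice path with steps `L` starting at `p`. -/
def verts : (Fin 2 → ℤ) → List (Fin 2 → ℤ) → List (Fin 2 → ℤ)
  | p, [] => [p]
  | p, d :: L => p :: verts (p + d) L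

lemma LPos.add {d e : Fin 2 → ℤ} (h : LPos d) (h' : LPos e) : LPos (d + e) := by
  unfold LPos at *
  simp only [Pi.add_apply]
  omega

lemma LPos.tri (d : Fin 2 → ℤ) : d = 0 ∨ LPos d ∨ LPos (-d) := by
  by_cases h : d 0 = 0 ∧ d 1 = 0
  · left; ext i; fin_cases i
    · exact h.1
    · exact h.2
  · right; unfold LPos; simp only [Pi.neg_apply]; omega

lemma LPos.not_neg {d : Fin 2 → ℤ} (h : LPos d) : ¬ LPos (-d) := by
  unfold LPos at *; simp only [Pi.neg_apply]; omega

lemma LPos.ne {d : Fin 2 → ℤ} (h : LPos d) : d ≠ 0 := by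
  rintro rfl; simp [LPos] at h

/-- Steepest and farthest. -/
def Stp (r s : Fin 2 → ℤ) : Prop :=
  det2 r s < 0 ∨ (det2 r s = 0 ∧ s 0 ≤ r 0 ∧ (r 0 = 0 → s 1 ≤ r 1))

lemma Stp.refl (r : Fin 2 → ℤ) : Stp r r := by
  right; refine ⟨by unfold det2; ring, le_rfl, fun _ => le_rfl⟩

lemma det2_antisymm (r s : Fin 2 → ℤ) : det2 r s = - det2 s r := by unfold det2; ring

lemma det2_plucker (r s u : Fin 2 → ℤ) :
    s 0 * det2 r u = r 0 * det2 s u + u 0 * det2 r s := by unfold det2; ring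

lemma Stp.total {r s : Fin 2 → ℤ} (hr : LPos r) (hs : LPos s) : Stp r s ∨ Stp s r := by
  rcases lt_trichotomy (det2 r s) 0 with h | h | h
  · exact Or.inl (Or.inl h)
  · have h' : det2 s r = 0 := by rw [det2_antisymm, h]; rfl
    have key : r 0 = 0 ↔ s 0 = 0 := by
      unfold det2 at h
      constructor
      · intro e
        have : r 1 ≠ 0 := by rcases hr with a | a <;> omega
        rw [e] at h
        have : r 1 * s 0 = 0 := by linarith
        rcases mul_eq_zero.1 this with a | a
        · contradiction
        · exact a
      · intro e
        have : s 1 ≠ 0 := by rcases hs with a | a <;> omega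
        rw [e] at h
        have : r 0 * s 1 = 0 := by linarith
        rcases mul_eq_zero.1 this with a | a
        · exact a
        · contradiction
    by_cases e : r 0 = 0
    · have e' := key.1 e
      rcases le_total (s 1) (r 1) with l | l
      · exact Or.inl (Or.inr ⟨h, by omega, fun _ => l⟩)
      · exact Or.inr (Or.inr ⟨h', by omega, fun _ => l⟩)
    · have e' : s 0 ≠ 0 := fun a => e (key.2 a)
      rcases le_total (s 0) (r 0) with l | l
      · exact Or.inl (Or.inr ⟨h, l, fun a => absurd a e⟩)
      · exact Or.inr (Or.inr ⟨h', l, fun a => absurd a e'⟩)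
  · right; left; rw [det2_antisymm]; omega

lemma Stp.trans {r s u : Fin 2 → ℤ} (hr : LPos r) (hs : LPos s) (hu : LPos u)
    (h1 : Stp r s) (h2 : Stp s u) : Stp r u := by
  have d1 : det2 r s ≤ 0 := by rcases h1 with h | h <;> omega
  have d2 : det2 s u ≤ 0 := by rcases h2 with h | h <;> omega
  have hr0 : 0 ≤ r 0 := by rcases hr with h | h <;> omega
  have hu0 : 0 ≤ u 0 := by rcases hu with h | h <;> omega
  have pl := det2_plucker r s u
  have m1 : r 0 * det2 s u ≤ 0 := mul_nonpos_of_nonneg_of_nonpos hr0 d2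
  have m2 : u 0 * det2 r s ≤ 0 := mul_nonpos_of_nonneg_of_nonpos hu0 d1
  rcases hs with s0 | ⟨s0, s1⟩
  · have d3 : det2 r u ≤ 0 := by
      by_contra hc
      push Not at hc
      have := mul_pos s0 hc
      omega
    rcases lt_or_eq_of_le d3 with d3 | d3
    · exact Or.inl d3
    · right
      rw [d3, mul_zero] at pl
      have z1 : r 0 * det2 s u = 0 := by omega
      have z2 : u 0 * det2 r s = 0 := by omega
      have hr00 : r 0 ≠ 0 := by
        intro e
        have r1 : 0 < r 1 := by rcases hr with h | h <;> omega
        have : det2 r s < 0 := by unfold det2; rw [e]; nlinarith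
        have u00 : u 0 = 0 := by rcases mul_eq_zero.1 z2 with a | a <;> omega
        have u1 : 0 < u 1 := by rcases hu with h | h <;> omega
        have : 0 < det2 s u := by unfold det2; rw [u00]; nlinarith
        omega
      have e1 : det2 s u = 0 := by rcases mul_eq_zero.1 z1 with a | a <;> omega
      have l1 : u 0 ≤ s 0 := by rcases h2 with h | h <;> omega
      refine ⟨d3, ?_, fun a => absurd a hr00⟩
      rcases mul_eq_zero.1 z2 with a | a
      · omega
      · have : s 0 ≤ r 0 := by rcases h1 with h | h <;> omega
        omega
  · have e1 : det2 r s = r 0 * s 1 := by unfold det2; rw [s0]; ring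
    have r00 : r 0 = 0 := by
      by_contra hne
      have : 0 < r 0 * s 1 := mul_pos (by omega) s1
      omega
    have l1 : s 1 ≤ r 1 := by
      rcases h1 with h | h
      · rw [e1, r00] at h; simp at h
      · exact h.2.2 r00
    have e3 : det2 r u = - (r 1 * u 0) := by unfold det2; rw [r00]; ring
    have e4 : det2 s u = - (s 1 * u 0) := by unfold det2; rw [s0]; ring
    rcases hu0.lt_or_eq with l | l
    · left; rw [e3]
      have : 0 < r 1 * u 0 := mul_pos (by omega) l
      omega
    · right
      refine ⟨by rw [e3, ← l]; simp, by omega, fun _ => ?_⟩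
      rcases h2 with h | h
      · rw [e4, ← l] at h; simp at h
      · have := h.2.2 s0; omega

lemma det2_trans {r s u : Fin 2 → ℤ} (hr : LPos r) (hs : LPos s) (hu : LPos u)
    (h1 : det2 r s < 0) (h2 : det2 s u < 0) : det2 r u < 0 := by
  rcases Stp.trans hr hs hu (Or.inl h1) (Or.inl h2) with h | ⟨h, _, _⟩
  · exact h
  · exfalso
    have pl := det2_plucker r s u
    rw [h, mul_zero] at pl
    have hr0 : 0 ≤ r 0 := by rcases hr with h | h <;> omega
    have hu0 : 0 ≤ u 0 := by rcases hu with h | h <;> omega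
    have m1 : r 0 * det2 s u ≤ 0 := mul_nonpos_of_nonneg_of_nonpos hr0 h2.le
    have m2 : u 0 * det2 r s ≤ 0 := mul_nonpos_of_nonneg_of_nonpos hu0 h1.le
    have z1 : r 0 * det2 s u = 0 := by omega
    have z2 : u 0 * det2 r s = 0 := by omega
    have a1 : r 0 = 0 := by rcases mul_eq_zero.1 z1 with a | a <;> omega
    have a2 : u 0 = 0 := by rcases mul_eq_zero.1 z2 with a | a <;> omega
    have u1 : 0 < u 1 := by rcases hu with h | h <;> omega
    have s0 : 0 ≤ s 0 := by rcases hs with h | h <;> omega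
    have : det2 s u = s 0 * u 1 := by unfold det2; rw [a2]; ring
    have := mul_nonneg s0 u1.le
    omega

lemma exists_max_rel (D : Finset (Fin 2 → ℤ)) (hne : D.Nonempty) (hD : ∀ d ∈ D, LPos d) :
    ∃ r ∈ D, ∀ s ∈ D, Stp r s := by
  classical
  induction hne using Finset.Nonempty.cons_induction with
  | singleton a => exact ⟨a, by simp, by simp [Stp.refl]⟩
  | cons a D ha hne ih =>
    obtain ⟨r, hr, h⟩ := ih (fun d hd => hD d (by simp [hd]))
    have la := hD a (by simp)
    have lr := hD r (by simp [hr])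
    rcases Stp.total la lr with t | t
    · refine ⟨a, by simp, ?_⟩
      intro s hs
      rcases Finset.mem_cons.1 hs with rfl | hs'
      · exact Stp.refl _
      · exact Stp.trans la lr (hD s hs) t (h s hs')
    · refine ⟨r, by simp [hr], ?_⟩
      intro s hs
      rcases Finset.mem_cons.1 hs with rfl | hs'
      · exact t
      · exact h s hs'

lemma start_mem_verts (p : Fin 2 → ℤ) (L : List (Fin 2 → ℤ)) : p ∈ verts p L := by
  cases L <;> simp [verts]

lemma last_mem_verts (p : Fin 2 → ℤ) (L : List (Fin 2 → ℤ)) : p + L.sum ∈ verts p L := by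
  induction L generalizing p with
  | nil => simp [verts]
  | cons d L ih =>
    simp only [verts, List.sum_cons, ← add_assoc]
    exact List.mem_cons_of_mem _ (ih _)

lemma chain_exists : ∀ (N : ℕ) (S : Finset (Fin 2 → ℤ)), S.card ≤ N → ∀ p ∈ S,
    (∀ s ∈ S, s = p ∨ LPos (s - p)) → ∃ L : List (Fin 2 → ℤ), (∀ d ∈ L, LPos d) ∧
      L.Pairwise (fun d e => det2 d e < 0) ∧ (∀ v ∈ verts p L, v ∈ S) ∧
      (∀ s ∈ S, s = p + L.sum ∨ LPos (p + L.sum - s)) ∧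
      ∀ s ∈ S, ∃ z ∈ convexHull ℝ (intVec '' {v | v ∈ verts p L}), z 0 = s 0 ∧ (s 1 : ℝ) ≤ z 1 := by
  classical
  intro N
  induction N with
  | zero =>
    intro S hS p hp
    simp at hS; subst hS; simp at hp
  | succ N ih =>
    intro S hS p hp hmin
    by_cases hne : (S.erase p).Nonempty
    · set D := (S.erase p).image (fun s => s - p) with hD
      have hDpos : ∀ d ∈ D, LPos d := by
        intro d hd
        obtain ⟨s, hs, rfl⟩ := Finset.mem_image.1 hd
        rcases hmin s (Finset.mem_of_mem_erase hs) with e | e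
        · exact absurd e (Finset.ne_of_mem_erase hs)
        · exact e
      obtain ⟨d, hd, hmax⟩ := exists_max_rel D (hne.image _) hDpos
      have ld := hDpos d hd
      obtain ⟨r, hr, hrd⟩ := Finset.mem_image.1 hd
      have hrS := Finset.mem_of_mem_erase hr
      have hr' : r = p + d := by rw [← hrd]; abel
      set S' := S.filter (fun s => s = r ∨ LPos (s - r)) with hS'
      have hpS' : p ∉ S' := by
        intro h
        rcases (Finset.mem_filter.1 h).2 with e | e
        · exact Finset.ne_of_mem_erase hr e.symm
        · apply ld.not_neg
          rw [hr'] at e; convert e using 1; abel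
      have hcard : S'.card ≤ N := by
        have : S' ⊂ S := Finset.ssubset_iff_of_subset (Finset.filter_subset _ _) |>.2 ⟨p, hp, hpS'⟩
        have := Finset.card_lt_card this
        omega
      obtain ⟨L, l1, l2, l3, l4, l5⟩ := ih S' hcard r (Finset.mem_filter.2 ⟨hrS, Or.inl rfl⟩)
        (fun s hs => (Finset.mem_filter.1 hs).2)
      have hfirst : ∀ e ∈ L, det2 d e < 0 := by
        cases L with
        | nil => simp
        | cons e1 L' =>
          have le1 := l1 e1 (by simp)
          have hmem : r + e1 ∈ S := by
            have : r + e1 ∈ verts r (e1 :: L') := by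
              simp only [verts]; exact List.mem_cons_of_mem _ (start_mem_verts _ _)
            exact (Finset.mem_filter.1 (l3 _ this)).1
          have hne' : r + e1 ≠ p := by
            intro e
            rw [hr', add_assoc] at e
            exact (ld.add le1).ne (by simpa using e)
          have hr2 : Stp d (d + e1) := by
            apply hmax
            refine Finset.mem_image.2 ⟨r + e1, Finset.mem_erase.2 ⟨hne', hmem⟩, ?_⟩
            rw [hr']; abel
          have hdet : det2 d (d + e1) = det2 d e1 := by
            unfold det2; simp only [Pi.add_apply]; ring
          have h1 : det2 d e1 < 0 := by
            rcases hr2 with h | ⟨h, h', h''⟩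
            · rwa [hdet] at h
            · exfalso
              rw [hdet] at h
              simp only [Pi.add_apply] at h' h''
              rcases le1 with a | ⟨a, b⟩
              · omega
              · unfold det2 at h
                rw [a] at h
                have : d 0 * e1 1 = 0 := by linarith
                rcases mul_eq_zero.1 this with c | c
                · have := h'' c; omega
                · omega
          intro e he
          rcases List.mem_cons.1 he with rfl | he'
          · exact h1
          · exact det2_trans ld le1 (l1 e he) h1 ((List.pairwise_cons.1 l2).1 e he')
      have hq : p + (d :: L).sum = r + L.sum := by rw [hr', List.sum_cons]; abel
      have hlast : r + L.sum = r ∨ LPos (r + L.sum - r) := by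
        have := l3 _ (last_mem_verts r L)
        exact (Finset.mem_filter.1 this).2
      have hcase : ∀ s ∈ S, s ∈ S' ∨ LPos (r - s) := by
        intro s hs
        rcases LPos.tri (s - r) with e | e | e
        · exact Or.inl (Finset.mem_filter.2 ⟨hs, Or.inl (sub_eq_zero.1 e)⟩)
        · exact Or.inl (Finset.mem_filter.2 ⟨hs, Or.inr e⟩)
        · right; rwa [neg_sub] at e
      have hsub : convexHull ℝ (intVec '' {v | v ∈ verts r L}) ⊆
          convexHull ℝ (intVec '' {v | v ∈ verts p (d :: L)}) := by
        apply convexHull_mono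
        apply Set.image_mono
        intro v hv
        show v ∈ verts p (d :: L)
        simp only [verts]
        rw [← hr']
        exact List.mem_cons_of_mem _ hv
      refine ⟨d :: L, ?_, ?_, ?_, ?_, ?_⟩
      · intro e he
        rcases List.mem_cons.1 he with rfl | he'
        · exact ld
        · exact l1 e he'
      · exact List.pairwise_cons.2 ⟨hfirst, l2⟩
      · intro v hv
        simp only [verts] at hv
        rcases List.mem_cons.1 hv with rfl | hv'
        · exact hp
        · rw [← hr'] at hv'
          exact (Finset.mem_filter.1 (l3 v hv')).1
      · intro s hs
        rw [hq]
        rcases hcase s hs with h | h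
        · exact l4 s h
        · right
          rcases hlast with e | e
          · rwa [e]
          · have := e.add h
            convert this using 1; abel
      · intro s hs
        rcases hcase s hs with h | h
        · obtain ⟨z, hz, h1, h2⟩ := l5 s h
          exact ⟨z, hsub hz, h1, h2⟩
        · have hrm : intVec r ∈ convexHull ℝ (intVec '' {v | v ∈ verts p (d :: L)}) :=
            hsub (subset_convexHull ℝ _ ⟨r, start_mem_verts _ _, rfl⟩)
          have hpm : intVec p ∈ convexHull ℝ (intVec '' {v | v ∈ verts p (d :: L)}) :=
            subset_convexHull ℝ _ ⟨p, start_mem_verts _ _, rfl⟩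
          rcases hmin s hs with e | e
          · exact ⟨intVec p, hpm, by simp [intVec, e], by simp [intVec, e]⟩
          · have hsp : s ≠ p := fun a => e.ne (by simp [a])
            have hrel : Stp d (s - p) :=
              hmax _ (Finset.mem_image.2 ⟨s, Finset.mem_erase.2 ⟨hsp, hs⟩, rfl⟩)
            have hdet : det2 d (s - p) ≤ 0 := by rcases hrel with a | a <;> omega
            have r0 : r 0 = p 0 + d 0 := by rw [hr']; rfl
            have r1 : r 1 = p 1 + d 1 := by rw [hr']; rfl
            have s0 : p 0 ≤ s 0 := by
              rcases e with a | a <;> simp only [Pi.sub_apply] at a <;> omega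
            have s1 : s 0 ≤ r 0 := by
              rcases h with a | a <;> simp only [Pi.sub_apply] at a <;> omega
            by_cases hd0 : d 0 = 0
            · refine ⟨intVec r, hrm, ?_, ?_⟩
              · simp only [intVec]; norm_cast; omega
              · simp only [intVec]; norm_cast
                rcases h with a | a <;> simp only [Pi.sub_apply] at a <;> omega
            · have hd0' : 0 < d 0 := by rcases ld with a | a <;> omega
              have hd0r : (0 : ℝ) < d 0 := by exact_mod_cast hd0'
              have r0' : (r 0 : ℝ) = p 0 + d 0 := by exact_mod_cast r0
              have r1' : (r 1 : ℝ) = p 1 + d 1 := by exact_mod_cast r1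
              have s0' : (p 0 : ℝ) ≤ s 0 := by exact_mod_cast s0
              have s1' : (s 0 : ℝ) ≤ r 0 := by exact_mod_cast s1
              have hdet' : (d 0 : ℝ) * (s 1 - p 1) - d 1 * (s 0 - p 0) ≤ 0 := by
                unfold det2 at hdet
                simp only [Pi.sub_apply] at hdet
                exact_mod_cast hdet
              have := (convex_convexHull ℝ (intVec '' {v | v ∈ verts p (d :: L)})) hpm hrm
                (a := ((r 0 : ℝ) - s 0) / d 0) (b := ((s 0 : ℝ) - p 0) / d 0)
                (div_nonneg (by linarith) hd0r.le) (div_nonneg (by linarith) hd0r.le)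
                (by rw [r0']; field_simp; ring)
              refine ⟨_, this, ?_, ?_⟩
              · simp only [intVec, Pi.add_apply, Pi.smul_apply, smul_eq_mul]
                rw [r0']; field_simp; ring
              · simp only [intVec, Pi.add_apply, Pi.smul_apply, smul_eq_mul]
                rw [r1', r0', div_mul_eq_mul_div, div_mul_eq_mul_div, ← add_div, le_div_iff₀ hd0r]
                nlinarith
    · have hS1 : ∀ s ∈ S, s = p := by
        intro s hs
        by_contra hc
        exact hne ⟨s, Finset.mem_erase.2 ⟨hc, hs⟩⟩
      refine ⟨[], by simp, by simp, ?_, ?_, ?_⟩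
      · intro v hv; simp [verts] at hv; rwa [hv]
      · intro s hs; left; simp [hS1 s hs]
      · intro s hs
        refine ⟨intVec p, subset_convexHull ℝ _ ⟨p, by simp [verts], rfl⟩, ?_, ?_⟩ <;>
          simp [intVec, hS1 s hs]

/-- The symmetric polygon spanned by a lattice path and its point reflection. -/
def FL (p : Fin 2 → ℤ) (L : List (Fin 2 → ℤ)) : Set (Fin 2 → ℝ) :=
  convexHull ℝ (intVec '' {v | v ∈ verts p L ∨ p + (p + L.sum) - v ∈ verts p L})

lemma intVec_add {d : ℕ} (x y : Fin d → ℤ) : intVec (x + y) = intVec x + intVec y := by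
  ext i; simp [intVec]

lemma intVec_sub {d : ℕ} (x y : Fin d → ℤ) : intVec (x - y) = intVec x - intVec y := by
  ext i; simp [intVec]

lemma intVec_inj {d : ℕ} {x y : Fin d → ℤ} (h : intVec x = intVec y) : x = y := by
  ext i; have := congrFun h i; simpa [intVec] using this

lemma verts_translate (p v : Fin 2 → ℤ) (L : List (Fin 2 → ℤ)) :
    verts (p + v) L = (verts p L).map (fun x => x + v) := by
  induction L generalizing p with
  | nil => simp [verts]
  | cons d L ih =>
    simp only [verts, List.map_cons]
    rw [← ih]; congr 2; abel

lemma convexHull_image_affine (σ : (Fin 2 → ℝ) ≃ᵃ[ℝ] (Fin 2 → ℝ)) (A : Set (Fin 2 → ℝ)) :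
    σ '' convexHull ℝ A = convexHull ℝ (σ '' A) :=
  AffineMap.image_convexHull (σ : (Fin 2 → ℝ) →ᵃ[ℝ] (Fin 2 → ℝ)) A

lemma FL_equiv (p p' : Fin 2 → ℤ) (L : List (Fin 2 → ℤ)) :
    LatticeEquiv 2 (FL p L) (FL p' L) := by
  obtain ⟨v, rfl⟩ : ∃ v, p' = p + v := ⟨p' - p, by abel⟩
  refine ⟨AffineEquiv.constVAdd ℝ _ (intVec v), ?_, ?_⟩
  · ext x
    simp only [latticeSet, Set.mem_image, Set.mem_range, exists_exists_eq_and,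
      AffineEquiv.constVAdd_apply, vadd_eq_add]
    constructor
    · rintro ⟨y, rfl⟩; exact ⟨v + y, intVec_add _ _⟩
    · rintro ⟨y, rfl⟩; exact ⟨y - v, by rw [intVec_sub]; abel⟩
  · unfold FL
    rw [convexHull_image_affine, ← Set.image_comp]
    congr 1
    have key : ∀ x, x + v ∈ verts (p + v) L ↔ x ∈ verts p L := by
      intro x; rw [verts_translate]; simp
    ext y
    constructor
    · rintro ⟨x, hx, rfl⟩
      refine ⟨x - v, ?_, ?_⟩
      · rcases hx with h | h
        · left; rw [← key]; simpa using h
        · right; rw [← key]; convert h using 1; abel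
      · simp [intVec_sub]
    · rintro ⟨x, hx, rfl⟩
      refine ⟨x + v, ?_, ?_⟩
      · rcases hx with h | h
        · left; rwa [key]
        · right; rw [← key] at h; convert h using 1; abel
      · simp [intVec_add, add_comm]

lemma exists_lexmin (S : Finset (Fin 2 → ℤ)) (hne : S.Nonempty) :
    ∃ p ∈ S, ∀ s ∈ S, s = p ∨ LPos (s - p) := by
  obtain ⟨p, hp, h⟩ := Finset.exists_min_image S (fun s => toLex (s 0, s 1)) hne
  refine ⟨p, hp, fun s hs => ?_⟩
  have := h s hs
  rw [Prod.Lex.toLex_le_toLex] at this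
  rcases LPos.tri (s - p) with e | e | e
  · exact Or.inl (sub_eq_zero.1 e)
  · exact Or.inr e
  · exfalso
    unfold LPos at e
    simp only [Pi.neg_apply, Pi.sub_apply] at e this
    omega

lemma sum_abs_bound (Y : ℤ) : ∀ (L : List (Fin 2 → ℤ)) (p : Fin 2 → ℤ), (∀ d ∈ L, LPos d) →
    L.Pairwise (fun d e => det2 d e < 0) → (∀ v ∈ verts p L, v 1 ≤ Y) →
    (L.map (fun d => |d 1|)).sum ≤ 2 * Y - p 1 - (p + L.sum) 1 := by
  intro L
  induction L with
  | nil =>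
    intro p _ _ h
    have := h p (by simp [verts])
    simp; omega
  | cons d L ih =>
    intro p h1 h2 h3
    have l1 : ∀ e ∈ L, LPos e := fun e he => h1 e (by simp [he])
    have l2 := List.pairwise_cons.1 h2
    have hi := ih (p + d) l1 l2.2 (fun v hv => h3 v (by simp [verts, hv]))
    have hpY := h3 p (start_mem_verts _ _)
    simp only [List.map_cons, List.sum_cons, Pi.add_apply] at hi ⊢
    by_cases hd : 0 ≤ d 1
    · rw [abs_of_nonneg hd]; omega
    · push Not at hd
      have hd0 : 0 < d 0 := by rcases h1 d (by simp) with a | a <;> omega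
      have hneg : ∀ e ∈ L, e 1 ≤ 0 := by
        intro e he
        have a := l2.1 e he
        have b : 0 ≤ e 0 := by rcases l1 e he with a | a <;> omega
        unfold det2 at a
        by_contra hc
        push Not at hc
        have := mul_pos hd0 hc
        have := mul_nonneg (neg_nonneg.2 hd.le) b
        nlinarith
      have : (L.map (fun d => |d 1|)).sum = - L.sum 1 := by
        clear hi ih h1 h2 h3 l1 l2
        induction L with
        | nil => simp
        | cons e L ih2 =>
          simp only [List.map_cons, List.sum_cons, Pi.add_apply]
          rw [ih2 (fun e he => hneg e (by simp [he])), abs_of_nonpos (hneg e (by simp))]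
          ring
      rw [this, abs_of_neg hd]; omega

lemma symm_polygon (S : Finset (Fin 2 → ℤ)) (hne : S.Nonempty) (w : Fin 2 → ℤ)
    (hw : ∀ s ∈ S, w - s ∈ S) (a b : ℤ) (ha : ∀ s ∈ S, |2 * s 0 - w 0| ≤ a)
    (hb : ∀ s ∈ S, |2 * s 1 - w 1| ≤ b) :
    ∃ (p : Fin 2 → ℤ) (L : List (Fin 2 → ℤ)), (∀ d ∈ L, LPos d) ∧
      L.Pairwise (fun d e => det2 d e < 0) ∧
      convexHull ℝ (intVec '' (S : Set (Fin 2 → ℤ))) = FL p L ∧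
      (L.map (fun d => d 0)).sum ≤ a ∧ (L.map (fun d => |d 1|)).sum ≤ 2 * b := by
  obtain ⟨p, hp, hmin⟩ := exists_lexmin S hne
  obtain ⟨L, l1, l2, l3, l4, l5⟩ := chain_exists S.card S le_rfl p hp hmin
  have hqS : p + L.sum ∈ S := l3 _ (last_mem_verts p L)
  have hwpq : w = p + (p + L.sum) := by
    rcases hmin _ (hw _ hqS) with e | e
    · exact sub_eq_iff_eq_add.1 e
    · rcases l4 _ (hw _ hp) with e' | e'
      · rw [← e']; abel
      · exact absurd (by convert e' using 1; abel) e.not_neg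
  refine ⟨p, L, l1, l2, ?_, ?_, ?_⟩
  · set C := FL p L with hC
    have hCc : Convex ℝ C := convex_convexHull _ _
    apply Set.Subset.antisymm
    · apply convexHull_min _ hCc
      rintro _ ⟨s, hs, rfl⟩
      have hsub1 : convexHull ℝ (intVec '' {v | v ∈ verts p L}) ⊆ C :=
        convexHull_mono (Set.image_mono (fun v hv => Or.inl hv))
      have hrefl : ∀ z ∈ C, intVec w - z ∈ C := by
        intro z hz
        have h1 : (AffineEquiv.constVSub ℝ (intVec w)) '' C = C := by
          rw [hC]; unfold FL
          rw [convexHull_image_affine, ← Set.image_comp]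
          congr 1
          ext y
          constructor
          · rintro ⟨x, hx, rfl⟩
            refine ⟨w - x, ?_, by simp [intVec_sub]⟩
            rw [hwpq]
            rcases hx with h | h
            · right; simpa using h
            · left; exact h
          · rintro ⟨x, hx, rfl⟩
            refine ⟨w - x, ?_, by simp [intVec_sub]⟩
            rw [hwpq]
            rcases hx with h | h
            · right; simpa using h
            · left; exact h
        rw [← h1]
        exact ⟨z, hz, by simp⟩
      obtain ⟨z, hz, z0, z1⟩ := l5 s hs
      obtain ⟨y, hy, y0, y1⟩ := l5 _ (hw s hs)
      have hz' := hsub1 hz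
      have hy' := hrefl _ (hsub1 hy)
      simp only [Pi.sub_apply, Int.cast_sub] at y0 y1
      have ez : z = ![(s 0 : ℝ), z 1] := by ext i; fin_cases i <;> simp [z0]
      have ey : intVec w - y = ![(s 0 : ℝ), w 1 - y 1] := by
        ext i; fin_cases i <;> simp [y0, intVec]
      have es : intVec s = ![(s 0 : ℝ), s 1] := by ext i; fin_cases i <;> simp [intVec]
      rw [ez] at hz'
      rw [ey] at hy'
      rw [es]
      exact mem_seg_of hCc hy' hz' (by linarith) z1
    · apply convexHull_mono
      apply Set.image_mono
      rintro v (h | h)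
      · exact l3 v h
      · have := hw _ (l3 _ h)
        rw [← hwpq, sub_sub_cancel] at this
        exact this
  · have e : (L.map (fun d => d 0)).sum = L.sum 0 := by
      clear l1 l2 l3 l4 l5 hqS hwpq
      induction L with
      | nil => simp
      | cons d L ih => simp [ih]
    rw [e]
    have := ha p hp
    have h2 := congrFun hwpq 0
    simp only [Pi.add_apply] at h2
    rw [abs_le] at this
    omega
  · by_cases hY : ∃ Y : ℤ, ∀ v ∈ S, v 1 ≤ Y ∧ 2 * Y - w 1 ≤ b
    · obtain ⟨Y, hY⟩ := hY
      have := sum_abs_bound Y L p l1 l2 (fun v hv => (hY v (l3 v hv)).1)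
      have h2 := congrFun hwpq 1
      have h3 := (hY p hp).2
      have h4 := hb p hp
      have : 0 ≤ b := le_trans (abs_nonneg _) h4
      simp only [Pi.add_apply] at *
      omega
    · exfalso
      apply hY
      obtain ⟨t, ht, hm⟩ := Finset.exists_max_image S (fun s => s 1) hne
      refine ⟨t 1, fun v hv => ⟨hm v hv, ?_⟩⟩
      exact (abs_le.1 (hb t ht)).2

lemma exists_symm_rep (P : Set (Fin 2 → ℝ)) (hP : IsConvexLatticePolytope 2 P)
    (hs : IsCentrallySymmetric 2 P) (hne : P.Nonempty) :
    ∃ (S : Finset (Fin 2 → ℤ)) (w : Fin 2 → ℤ), S.Nonempty ∧ (∀ s ∈ S, w - s ∈ S) ∧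
      P = convexHull ℝ (intVec '' (S : Set (Fin 2 → ℤ))) := by
  classical
  obtain ⟨V, hV⟩ := hP
  obtain ⟨c, hc⟩ := hs
  have hfin : (intVec '' (V : Set (Fin 2 → ℤ))).Finite := V.finite_toSet.image _
  have hcomp : IsCompact P := by rw [hV]; exact hfin.isCompact_convexHull ℝ
  have hconv : Convex ℝ P := by rw [hV]; exact convex_convexHull _ _
  obtain ⟨x, hx⟩ := hcomp.extremePoints_nonempty hne
  have hext : ∀ y ∈ P.extremePoints ℝ, ∃ v ∈ V, intVec v = y := by
    intro y hy
    rw [hV] at hy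
    obtain ⟨v, hv, e⟩ := extremePoints_convexHull_subset (𝕜 := ℝ) hy
    exact ⟨v, hv, e⟩
  have hx' : (2 : ℝ) • c - x ∈ P.extremePoints ℝ := by
    rw [mem_extremePoints] at hx ⊢
    refine ⟨(hc x).1 hx.1, ?_⟩
    intro x₁ h1 x₂ h2 h3
    have := hx.2 _ ((hc x₁).1 h1) _ ((hc x₂).1 h2) (by
      obtain ⟨a, b, ha, hb, hab, e⟩ := h3
      refine ⟨a, b, ha, hb, hab, ?_⟩
      have e2 : a • ((2 : ℝ) • c - x₁) + b • ((2 : ℝ) • c - x₂) =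
          (a + b) • ((2 : ℝ) • c) - (a • x₁ + b • x₂) := by
        rw [smul_sub, smul_sub, add_smul]; abel
      rw [e2, hab, e, one_smul, sub_sub_cancel])
    rw [← this.1]
    exact ⟨by rw [sub_sub_cancel], by rw [this.1, ← this.2, sub_sub_cancel]⟩
  obtain ⟨v1, hv1, e1⟩ := hext _ hx
  obtain ⟨v2, hv2, e2⟩ := hext _ hx'
  have hw : (2 : ℝ) • c = intVec (v1 + v2) := by
    rw [intVec_add, e1, e2]; abel
  refine ⟨V ∪ V.image (fun v => (v1 + v2) - v), v1 + v2, ⟨v1, by simp [hv1]⟩, ?_, ?_⟩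
  · intro s hs
    rcases Finset.mem_union.1 hs with h | h
    · exact Finset.mem_union_right _ (Finset.mem_image_of_mem _ h)
    · obtain ⟨v, hv, rfl⟩ := Finset.mem_image.1 h
      rw [sub_sub_cancel]
      exact Finset.mem_union_left _ hv
  · apply Set.Subset.antisymm
    · conv_lhs => rw [hV]
      apply convexHull_mono
      apply Set.image_mono
      simp
    · apply convexHull_min _ hconv
      have hVP : ∀ v ∈ V, intVec v ∈ P := by
        intro v hv
        rw [hV]; exact subset_convexHull ℝ _ ⟨v, hv, rfl⟩
      rintro _ ⟨s, hs, rfl⟩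
      rcases Finset.mem_union.1 (Finset.mem_coe.1 hs) with h | h
      · exact hVP s h
      · obtain ⟨v, hv, rfl⟩ := Finset.mem_image.1 h
        rw [intVec_sub, ← hw]
        exact (hc _).1 (hVP v hv)

lemma intVec_mulVec (M : Matrix (Fin 2) (Fin 2) ℤ) (x : Fin 2 → ℤ) :
    intVec (M.mulVec x) = (M.map (Int.cast : ℤ → ℝ)).mulVec (intVec x) := by
  ext i
  simp [intVec, Matrix.mulVec, dotProduct, Fin.sum_univ_two]

lemma unimod (M N : Matrix (Fin 2) (Fin 2) ℤ) (h1 : M * N = 1) (h2 : N * M = 1)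
    (A : Set (Fin 2 → ℤ)) :
    LatticeEquiv 2 (convexHull ℝ (intVec '' A)) (convexHull ℝ (intVec '' (M.mulVec '' A))) ∧
    volume (convexHull ℝ (intVec '' (M.mulVec '' A))) = volume (convexHull ℝ (intVec '' A)) := by
  have c1 : M.map (Int.cast : ℤ → ℝ) * N.map (Int.cast : ℤ → ℝ) = 1 := by
    have e1 := Matrix.map_mul (L := M) (M := N) (f := Int.castRingHom ℝ)
    rw [h1, Matrix.map_one _ (map_zero _) (map_one _)] at e1
    exact e1.symm
  have c2 : N.map (Int.cast : ℤ → ℝ) * M.map (Int.cast : ℤ → ℝ) = 1 := by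
    have e1 := Matrix.map_mul (L := N) (M := M) (f := Int.castRingHom ℝ)
    rw [h2, Matrix.map_one _ (map_zero _) (map_one _)] at e1
    exact e1.symm
  set e : (Fin 2 → ℝ) ≃ₗ[ℝ] (Fin 2 → ℝ) := Matrix.toLin'OfInv c2 c1 with he
  have hex : ∀ x, e x = (M.map (Int.cast : ℤ → ℝ)).mulVec x := by
    intro x; rfl
  have him : e.toAffineEquiv '' convexHull ℝ (intVec '' A) =
      convexHull ℝ (intVec '' (M.mulVec '' A)) := by
    rw [convexHull_image_affine, ← Set.image_comp, ← Set.image_comp]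
    congr 1
    apply Set.image_congr
    intro x _
    simp only [Function.comp, intVec_mulVec]
    exact hex _
  refine ⟨⟨e.toAffineEquiv, ?_, him.symm⟩, ?_⟩
  · ext x
    constructor
    · rintro ⟨_, ⟨y, rfl⟩, rfl⟩
      exact ⟨M.mulVec y, by rw [intVec_mulVec]; exact (hex _).symm⟩
    · rintro ⟨y, rfl⟩
      refine ⟨_, ⟨N.mulVec y, rfl⟩, ?_⟩
      show e _ = _
      rw [hex, ← intVec_mulVec, Matrix.mulVec_mulVec, h1, Matrix.one_mulVec]
  · rw [← him]
    have : (e.toAffineEquiv '' convexHull ℝ (intVec '' A)) =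
        (e : (Fin 2 → ℝ) →ₗ[ℝ] (Fin 2 → ℝ)) '' convexHull ℝ (intVec '' A) := rfl
    rw [this, Measure.addHaar_image_linearMap]
    have hd : LinearMap.det (e : (Fin 2 → ℝ) →ₗ[ℝ] (Fin 2 → ℝ)) = (M.det : ℝ) := by
      have : (e : (Fin 2 → ℝ) →ₗ[ℝ] (Fin 2 → ℝ)) =
          Matrix.toLin' (M.map (Int.cast : ℤ → ℝ)) :=
        LinearMap.ext (fun x => by rw [Matrix.toLin'_apply]; exact hex x)
      rw [this, LinearMap.det_toLin']
      have := (Int.castRingHom ℝ).map_det M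
      simpa using this.symm
    have hu : M.det = 1 ∨ M.det = -1 := by
      apply Int.isUnit_iff.1
      apply IsUnit.of_mul_eq_one N.det
      rw [← Matrix.det_mul, h1, Matrix.det_one]
    rw [hd]
    rcases hu with h | h <;> simp [h]

lemma area_lower (C : Set (Fin 2 → ℝ)) (hC : Convex ℝ C) (r r' t t' : Fin 2 → ℝ)
    (hr : r ∈ C) (hr' : r' ∈ C) (ht : t ∈ C) (ht' : t' ∈ C) (h : r + r' = t + t') :
    ENNReal.ofReal (|(r 0 - r' 0) * (t 1 - t' 1) - (r 1 - r' 1) * (t 0 - t' 0)| / 4) ≤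
      volume C := by
  set M : Matrix (Fin 2) (Fin 2) ℝ := !![(r 0 - r' 0) / 2, (t 0 - t' 0) / 2;
    (r 1 - r' 1) / 2, (t 1 - t' 1) / 2] with hM
  set Q : Set (Fin 2 → ℝ) := Set.Icc (fun _ => -(1 / 2)) (fun _ => 1 / 2) with hQ
  have hvQ : volume Q = 1 := by
    rw [hQ, Real.volume_Icc_pi]; norm_num
  have hv : volume ((fun x => (1 / 2 : ℝ) • (r + r') + x) '' (Matrix.toLin' M '' Q)) =
      ENNReal.ofReal (|(r 0 - r' 0) * (t 1 - t' 1) - (r 1 - r' 1) * (t 0 - t' 0)| / 4) := by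
    rw [Set.image_add_left, measure_preimage_add, Measure.addHaar_image_linearMap, hvQ, mul_one,
      LinearMap.det_toLin', hM, Matrix.det_fin_two_of]
    congr 1
    rw [show (4 : ℝ) = |4| by norm_num, ← abs_div]
    congr 1; norm_num; ring
  rw [← hv]
  apply measure_mono
  rintro _ ⟨_, ⟨x, hx, rfl⟩, rfl⟩
  have a0 := hx.1 0
  have a1 := hx.1 1
  have b0 := hx.2 0
  have b1 := hx.2 1
  simp only at a0 a1 b0 b1
  have hX := hC hr hr' (a := 1 / 2 + x 0) (b := 1 / 2 - x 0) (by linarith) (by linarith) (by ring)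
  have hY := hC ht ht' (a := 1 / 2 + x 1) (b := 1 / 2 - x 1) (by linarith) (by linarith) (by ring)
  have := hC hX hY (a := 1 / 2) (b := 1 / 2) (by norm_num) (by norm_num) (by norm_num)
  convert this using 1
  have e0 := congrFun h 0
  have e1 := congrFun h 1
  simp only [Pi.add_apply] at e0 e1
  ext i; fin_cases i
  · simp [hM, Matrix.mulVec, dotProduct, Fin.sum_univ_two]; linarith
  · simp [hM, Matrix.mulVec, dotProduct, Fin.sum_univ_two]; linarith

/-- `S` is a symmetric lattice representative of `P` of the same volume, with horizontal width
at most `a`. -/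
def Good (P : Set (Fin 2 → ℝ)) (S : Finset (Fin 2 → ℤ)) (w : Fin 2 → ℤ) (a : ℕ) : Prop :=
  S.Nonempty ∧ (∀ s ∈ S, w - s ∈ S) ∧
    LatticeEquiv 2 P (convexHull ℝ (intVec '' (S : Set (Fin 2 → ℤ)))) ∧
    volume (convexHull ℝ (intVec '' (S : Set (Fin 2 → ℤ)))) = volume P ∧
    ∀ s ∈ S, |2 * s 0 - w 0| ≤ a

lemma Good.map {P : Set (Fin 2 → ℝ)} {S : Finset (Fin 2 → ℤ)} {w : Fin 2 → ℤ} {a a' : ℕ}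
    (h : Good P S w a) (M N : Matrix (Fin 2) (Fin 2) ℤ) (h1 : M * N = 1) (h2 : N * M = 1)
    (hw : ∀ s ∈ S, |2 * (M.mulVec s) 0 - (M.mulVec w) 0| ≤ a') :
    Good P (S.image M.mulVec) (M.mulVec w) a' := by
  classical
  obtain ⟨g1, g2, g3, g4, g5⟩ := h
  obtain ⟨u1, u2⟩ := unimod M N h1 h2 (S : Set (Fin 2 → ℤ))
  refine ⟨g1.image _, ?_, ?_, ?_, ?_⟩
  · intro s hs
    obtain ⟨v, hv, rfl⟩ := Finset.mem_image.1 hs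
    rw [← Matrix.mulVec_sub]
    exact Finset.mem_image_of_mem _ (g2 v hv)
  · rw [Finset.coe_image]; exact g3.trans' u1
  · rw [Finset.coe_image, u2, g4]
  · intro s hs
    obtain ⟨v, hv, rfl⟩ := Finset.mem_image.1 hs
    exact hw v hv

lemma round_exists (t a : ℤ) (ha : 0 < a) : ∃ k : ℤ, 2 * |t + k * a| ≤ a := by
  refine ⟨-((2 * t + a) / (2 * a)), ?_⟩
  have h1 := Int.mul_ediv_add_emod (2 * t + a) (2 * a)
  have h2 := Int.emod_nonneg (2 * t + a) (show 2 * a ≠ 0 by omega)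
  have h3 := Int.emod_lt_of_pos (2 * t + a) (show 0 < 2 * a by omega)
  set q := (2 * t + a) / (2 * a)
  rw [show (2 : ℤ) * |t + -q * a| = |2 * (t + -q * a)| by rw [abs_mul]; rfl, abs_le]
  constructor <;> nlinarith

lemma box_rep (P : Set (Fin 2 → ℝ)) (hP : IsConvexLatticePolytope 2 P)
    (hs : IsCentrallySymmetric 2 P) (m : ℕ) (hm : 0 < m)
    (hv : volume P = ENNReal.ofReal ((m : ℝ) / 2)) :
    ∃ (S : Finset (Fin 2 → ℤ)) (w : Fin 2 → ℤ) (a b : ℕ), Good P S w a ∧ 1 ≤ a ∧ 1 ≤ b ∧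
      a * b ≤ 4 * m ∧ ∀ s ∈ S, |2 * s 1 - w 1| ≤ b := by
  classical
  have hvpos : volume P ≠ 0 := by
    rw [hv]; simp; omega
  have hne : P.Nonempty := by
    rw [Set.nonempty_iff_ne_empty]; rintro rfl; simp at hvpos
  obtain ⟨S0, w0, n0, s0, e0⟩ := exists_symm_rep P hP hs hne
  have hex : ∃ a : ℕ, ∃ S w, Good P S w a := by
    obtain ⟨t, ht, hmax⟩ := Finset.exists_max_image S0 (fun s => |2 * s 0 - w0 0|) n0
    refine ⟨(|2 * t 0 - w0 0|).toNat, S0, w0, n0, s0, ?_, ?_, ?_⟩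
    · rw [← e0]; exact LatticeEquiv.rfl' _
    · rw [← e0]
    · intro s hs
      rw [Int.toNat_of_nonneg (abs_nonneg _)]
      exact hmax s hs
  set a := Nat.find hex with ha
  obtain ⟨S1, w1, G1⟩ := Nat.find_spec hex
  have hmin : ∀ a' : ℕ, (∃ S w, Good P S w a') → a ≤ a' := fun a' h => Nat.find_min' hex h
  rw [← ha] at G1
  have hapos : 1 ≤ a := by
    by_contra hc
    have ha0 : a = 0 := by omega
    rw [ha0] at G1
    obtain ⟨g1, g2, g3, g4, g5⟩ := G1
    obtain ⟨t, ht, hmax⟩ := Finset.exists_max_image S1 (fun s => |s 1|) g1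
    apply hvpos
    rw [← g4]
    have hsub : convexHull ℝ (intVec '' (S1 : Set (Fin 2 → ℤ))) ⊆
        Set.Icc ![(w1 0 : ℝ) / 2, -(|t 1| : ℤ)] ![(w1 0 : ℝ) / 2, (|t 1| : ℤ)] := by
      apply convexHull_min _ (convex_Icc _ _)
      rintro _ ⟨s, hs, rfl⟩
      have h1 := g5 s hs
      have h2 := abs_le.1 (hmax s hs)
      have h3 : 2 * s 0 = w1 0 := by
        have h6 : 2 * s 0 - w1 0 = 0 := by simpa using h1
        omega
      have h3' : 2 * (s 0 : ℝ) = w1 0 := by exact_mod_cast h3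
      have h4 : -((|t 1| : ℤ) : ℝ) ≤ s 1 := by exact_mod_cast h2.1
      have h5 : (s 1 : ℝ) ≤ (|t 1| : ℤ) := by exact_mod_cast h2.2
      constructor
      · intro i; fin_cases i
        · simp [intVec]; linarith
        · simpa [intVec] using h4
      · intro i; fin_cases i
        · simp [intVec]; linarith
        · simpa [intVec] using h5
    apply measure_mono_null hsub
    rw [Real.volume_Icc_pi, Fin.prod_univ_two]
    simp
  obtain ⟨r, hr, hra⟩ : ∃ r ∈ S1, 2 * r 0 - w1 0 = a := by
    obtain ⟨g1, g2, g3, g4, g5⟩ := G1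
    by_contra hc
    push Not at hc
    have : a ≤ a - 1 := by
      apply hmin
      refine ⟨S1, w1, g1, g2, g3, g4, ?_⟩
      intro s hs
      have b1 := abs_le.1 (g5 s hs)
      have b2 := hc s hs
      have b3 := hc _ (g2 s hs)
      simp only [Pi.sub_apply] at b3
      rw [abs_le]
      omega
    omega
  obtain ⟨k, hk⟩ := round_exists (2 * r 1 - w1 1) a (by omega)
  set M : Matrix (Fin 2) (Fin 2) ℤ := !![1, 0; k, 1] with hM
  set N : Matrix (Fin 2) (Fin 2) ℤ := !![1, 0; -k, 1] with hN
  have hMN : M * N = 1 := by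
    rw [hM, hN, Matrix.mul_fin_two, Matrix.one_fin_two]; simp
  have hNM : N * M = 1 := by
    rw [hM, hN, Matrix.mul_fin_two, Matrix.one_fin_two]; simp
  have hM0 : ∀ x : Fin 2 → ℤ, (M.mulVec x) 0 = x 0 := by
    intro x; simp [hM, Matrix.mulVec, dotProduct, Fin.sum_univ_two]
  have hM1 : ∀ x : Fin 2 → ℤ, (M.mulVec x) 1 = k * x 0 + x 1 := by
    intro x; simp [hM, Matrix.mulVec, dotProduct, Fin.sum_univ_two]
  have G2 := G1.map (a' := a) M N hMN hNM (by
    intro s hs; rw [hM0, hM0]; exact G1.2.2.2.2 s hs)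
  set S2 := S1.image M.mulVec with hS2
  set w2 := M.mulVec w1 with hw2
  set r2 := M.mulVec r with hr2
  have hr2S : r2 ∈ S2 := Finset.mem_image_of_mem _ hr
  have hr20 : 2 * r2 0 - w2 0 = a := by rw [hr2, hw2, hM0, hM0, hra]
  have hr21 : 2 * |2 * r2 1 - w2 1| ≤ a := by
    rw [hr2, hw2, hM1, hM1]
    convert hk using 3
    rw [← hra]; ring
  obtain ⟨g1, g2, g3, g4, g5⟩ := id G2
  obtain ⟨t, ht, hmax⟩ := Finset.exists_max_image S2 (fun s => |2 * s 1 - w2 1|) g1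
  set b := (|2 * t 1 - w2 1|).toNat with hb
  have hb' : (b : ℤ) = |2 * t 1 - w2 1| := Int.toNat_of_nonneg (abs_nonneg _)
  have hab : a ≤ b := by
    apply hmin
    have hsw : !![(0 : ℤ), 1; 1, 0] * !![(0 : ℤ), 1; 1, 0] = 1 := by
      rw [Matrix.mul_fin_two, Matrix.one_fin_two]; simp
    refine ⟨_, _, G2.map (a' := b) !![0, 1; 1, 0] !![0, 1; 1, 0] hsw hsw ?_⟩
    intro s hs
    have := hmax s hs
    rw [hb']
    simpa [Matrix.mulVec, dotProduct, Fin.sum_univ_two] using this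
  obtain ⟨t', ht', htb⟩ : ∃ t' ∈ S2, 2 * t' 1 - w2 1 = b := by
    rcases abs_choice (2 * t 1 - w2 1) with e | e
    · exact ⟨t, ht, by rw [hb', e]⟩
    · refine ⟨w2 - t, g2 t ht, ?_⟩
      rw [hb', e]; simp only [Pi.sub_apply]; ring
  refine ⟨S2, w2, a, b, G2, hapos, hapos.trans hab, ?_, fun s hs => by rw [hb']; exact hmax s hs⟩
  set C := convexHull ℝ (intVec '' (S2 : Set (Fin 2 → ℤ))) with hC
  have hmem : ∀ s ∈ S2, intVec s ∈ C := fun s hs => subset_convexHull ℝ _ ⟨s, hs, rfl⟩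
  have harea := area_lower C (convex_convexHull _ _) (intVec r2) (intVec (w2 - r2)) (intVec t')
    (intVec (w2 - t')) (hmem _ hr2S) (hmem _ (g2 _ hr2S)) (hmem _ ht') (hmem _ (g2 _ ht'))
    (by rw [intVec_sub, intVec_sub]; abel)
  rw [g4, hv, ENNReal.ofReal_le_ofReal_iff (by positivity)] at harea
  have ht0 := abs_le.1 (g5 t' ht')
  have hr1 := hr21
  set X := 2 * r2 1 - w2 1 with hX
  set Z := 2 * t' 0 - w2 0 with hZ
  have key : (a : ℤ) * b - X * Z ≤ 2 * m := by
    have e : (((a : ℤ) * b - X * Z : ℤ) : ℝ) = (intVec r2 0 - intVec (w2 - r2) 0) *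
        (intVec t' 1 - intVec (w2 - t') 1) - (intVec r2 1 - intVec (w2 - r2) 1) *
        (intVec t' 0 - intVec (w2 - t') 0) := by
      rw [← hr20, ← htb, hX, hZ]
      simp only [intVec, Pi.sub_apply]; push_cast; ring
    have h2 := le_abs_self (((a : ℤ) * b - X * Z : ℤ) : ℝ)
    rw [e] at h2
    have h3 : (((a : ℤ) * b - X * Z : ℤ) : ℝ) ≤ 2 * m := by rw [e]; linarith
    exact_mod_cast h3
  have hXZ : 2 * (X * Z) ≤ a * a := by
    have h1 : X * Z ≤ |X| * |Z| := by rw [← abs_mul]; exact le_abs_self _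
    have h2 : |Z| ≤ a := g5 t' ht'
    have h3 : 0 ≤ |X| := abs_nonneg _
    nlinarith
  have hab' : (a : ℤ) ≤ b := by exact_mod_cast hab
  have : (a : ℤ) * b ≤ 4 * m := by nlinarith
  exact_mod_cast this

lemma geom_bound (s : ℝ) (hs : 0 < s) (N : ℕ) :
    ∑ i ∈ Finset.range N, Real.exp (-(s * ((i : ℝ) + 1))) ≤ 1 / s := by
  have key : ∑ i ∈ Finset.range N, Real.exp (-(s * ((i : ℝ) + 1))) ≤
      (1 - Real.exp (-(s * N))) / s := by
    induction N with
    | zero => simp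
    | succ n ih =>
      rw [Finset.sum_range_succ]
      refine (add_le_add_left ih _).trans ?_
      rw [← sub_nonneg]
      have h1 : Real.exp (-(s * n)) = Real.exp (-(s * ((n : ℝ) + 1))) * Real.exp s := by
        rw [← Real.exp_add]; congr 1; ring
      have h2 := Real.add_one_le_exp s
      have h3 := Real.exp_pos (-(s * ((n : ℝ) + 1)))
      push_cast
      have e : (1 - Real.exp (-(s * ((n : ℝ) + 1)))) / s - ((1 - Real.exp (-(s * n))) / s +
          Real.exp (-(s * ((n : ℝ) + 1)))) =
          Real.exp (-(s * ((n : ℝ) + 1))) * (Real.exp s - 1 - s) / s := by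
        rw [h1]; field_simp; ring
      rw [e]
      apply div_nonneg _ hs.le
      apply mul_nonneg h3.le; linarith
  refine key.trans ?_
  apply div_le_div_of_nonneg_right _ hs.le
  have := Real.exp_pos (-(s * N)); linarith

lemma gf_bound {α : Type*} [DecidableEq α] (E : Finset α) (f : α → ℝ) (c : ℝ) :
    ((E.powerset.filter (fun D => ∑ d ∈ D, f d ≤ c)).card : ℝ) ≤
      Real.exp (c + ∑ d ∈ E, Real.exp (-f d)) := by
  have h1 : ((E.powerset.filter (fun D => ∑ d ∈ D, f d ≤ c)).card : ℝ) ≤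
      ∑ D ∈ E.powerset.filter (fun D => ∑ d ∈ D, f d ≤ c),
        Real.exp c * ∏ d ∈ D, Real.exp (-f d) := by
    rw [Finset.card_eq_sum_ones]
    push_cast
    apply Finset.sum_le_sum
    intro D hD
    have hD := (Finset.mem_filter.1 hD).2
    rw [← Real.exp_sum, ← Real.exp_add, Finset.sum_neg_distrib]
    apply Real.one_le_exp; linarith
  refine h1.trans ?_
  refine (Finset.sum_le_sum_of_subset_of_nonneg (Finset.filter_subset _ _)
    (fun D _ _ => by positivity)).trans ?_
  rw [← Finset.mul_sum, ← Finset.prod_one_add, Real.exp_add]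
  apply mul_le_mul_of_nonneg_left _ (Real.exp_pos _).le
  exact Real.prod_one_add_le_exp_sum _ (fun i => (Real.exp_pos _).le)

/-- Box of steps with both coordinates nonzero. -/
def boxE (a b : ℕ) : Finset (Fin 2 → ℤ) :=
  ((Finset.range a ×ˢ Finset.range (2 * b)) ×ˢ ({1, -1} : Finset ℤ)).image
    (fun q => ![(q.1.1 : ℤ) + 1, q.2 * ((q.1.2 : ℤ) + 1)])

lemma mem_boxE (a b : ℕ) (d : Fin 2 → ℤ) (h0 : 0 < d 0) (h0' : d 0 ≤ a) (h1 : d 1 ≠ 0)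
    (h1' : |d 1| ≤ 2 * b) : d ∈ boxE a b := by
  unfold boxE
  rw [Finset.mem_image]
  refine ⟨(((d 0 - 1).toNat, (|d 1| - 1).toNat), if 0 < d 1 then 1 else -1), ?_, ?_⟩
  · have : 0 < |d 1| := abs_pos.2 h1
    simp only [Finset.mem_product, Finset.mem_range, Finset.mem_insert, Finset.mem_singleton]
    refine ⟨⟨by omega, by omega⟩, ?_⟩
    split_ifs <;> simp
  · have : 0 < |d 1| := abs_pos.2 h1
    ext i; fin_cases i
    · simp; omega
    · simp only [Fin.mk_one, Matrix.cons_val_one, Matrix.cons_val_fin_one, Fin.isValue]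
      rw [Int.toNat_of_nonneg (by omega)]
      split_ifs with h
      · rw [abs_of_pos h]; ring
      · rw [abs_of_nonpos (by omega)]; ring

lemma sum_boxE (a b : ℕ) (s t : ℝ) (hs : 0 < s) (ht : 0 < t) :
    ∑ d ∈ boxE a b, Real.exp (-(s * (d 0 : ℝ) + t * |(d 1 : ℝ)|)) ≤ 2 * (1 / s * (1 / t)) := by
  unfold boxE
  rw [Finset.sum_image]
  · have : ∀ q ∈ (Finset.range a ×ˢ Finset.range (2 * b)) ×ˢ ({1, -1} : Finset ℤ),
        Real.exp (-(s * ((![(q.1.1 : ℤ) + 1, q.2 * ((q.1.2 : ℤ) + 1)] 0 : ℤ) : ℝ) +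
          t * |((![(q.1.1 : ℤ) + 1, q.2 * ((q.1.2 : ℤ) + 1)] 1 : ℤ) : ℝ)|)) =
        Real.exp (-(s * ((q.1.1 : ℝ) + 1))) * Real.exp (-(t * ((q.1.2 : ℝ) + 1))) := by
      intro q hq
      have h2 := (Finset.mem_product.1 hq).2
      rw [← Real.exp_add]
      congr 1
      have h3 : |(q.2 : ℝ)| = 1 := by
        simp only [Finset.mem_insert, Finset.mem_singleton] at h2
        rcases h2 with h | h <;> rw [h] <;> simp
      have h4 : |((q.1.2 : ℝ) + 1)| = (q.1.2 : ℝ) + 1 := abs_of_pos (by positivity)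
      simp [abs_mul, h3, h4]
      ring
    rw [Finset.sum_congr rfl this, Finset.sum_product]
    simp only [Finset.sum_const]
    rw [← Finset.smul_sum, Finset.sum_product]
    simp only []
    rw [← Finset.sum_mul_sum]
    have hc : ({1, -1} : Finset ℤ).card = 2 := by decide
    rw [hc, nsmul_eq_mul]
    push_cast
    apply mul_le_mul_of_nonneg_left _ (by norm_num)
    apply mul_le_mul (geom_bound s hs a) (geom_bound t ht _) _ (by positivity)
    exact Finset.sum_nonneg (fun i _ => (Real.exp_pos _).le)
  · intro q hq q' hq' h
    have hq2 := (Finset.mem_product.1 hq).2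
    have hq2' := (Finset.mem_product.1 hq').2
    have e0 := congrFun h 0
    have e1 := congrFun h 1
    simp only [Finset.mem_insert, Finset.mem_singleton] at hq2 hq2'
    simp at e0 e1
    obtain ⟨⟨x, y⟩, e⟩ := q
    obtain ⟨⟨x', y'⟩, e'⟩ := q'
    simp only at *
    have : e = e' ∧ y = y' := by
      rcases hq2 with rfl | rfl <;> rcases hq2' with rfl | rfl <;> omega
    simp [this.1, this.2, e0]

/-- cube root scale -/
def lam (a b : ℕ) : ℝ := ((a : ℝ) * b) ^ ((1 : ℝ) / 3)

lemma lam_pos {a b : ℕ} (ha : 1 ≤ a) (hb : 1 ≤ b) : 0 < lam a b := by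
  unfold lam
  have : (0 : ℝ) < a := by exact_mod_cast ha
  have : (0 : ℝ) < b := by exact_mod_cast hb
  positivity

lemma cbrt_cube {x : ℝ} (hx : 0 ≤ x) : (x ^ ((1 : ℝ) / 3)) ^ 3 = x := by
  rw [← Real.rpow_natCast, ← Real.rpow_mul hx]; norm_num

/-- Candidate sets of slanted steps. -/
def slant (a b : ℕ) : Finset (Finset (Fin 2 → ℤ)) := by
  classical
  exact (boxE a b).powerset.filter (fun D => ∑ d ∈ D, (lam a b / a * (d 0 : ℝ) +
    lam a b / b * |(d 1 : ℝ)|) ≤ 3 * lam a b)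

lemma card_slant (a b : ℕ) (ha : 1 ≤ a) (hb : 1 ≤ b) :
    ((slant a b).card : ℝ) ≤ Real.exp (5 * lam a b) := by
  classical
  have hl := lam_pos ha hb
  have ha' : (0 : ℝ) < a := by exact_mod_cast ha
  have hb' : (0 : ℝ) < b := by exact_mod_cast hb
  have h3 : lam a b ^ 3 = a * b := cbrt_cube (by positivity)
  have h1 := gf_bound (boxE a b) (fun d => lam a b / a * (d 0 : ℝ) +
    lam a b / b * |(d 1 : ℝ)|) (3 * lam a b)
  have h2 := sum_boxE a b (lam a b / a) (lam a b / b) (by positivity) (by positivity)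
  unfold slant
  refine h1.trans ?_
  apply Real.exp_le_exp.2
  have h4 : 2 * (1 / (lam a b / a) * (1 / (lam a b / b))) = 2 * lam a b := by
    have : 1 / (lam a b / a) * (1 / (lam a b / b)) = lam a b ^ 3 / lam a b ^ 2 := by
      rw [h3]; field_simp
    rw [this]; field_simp
  linarith

/-- Optional axis step. -/
def optv (x y : ℕ) : Finset (Fin 2 → ℤ) :=
  if x = 0 ∧ y = 0 then ∅ else {![(x : ℤ), (y : ℤ)]}

/-- All candidate step sets for a box. -/
def cand (a b : ℕ) : Finset (Finset (Fin 2 → ℤ)) := by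
  classical
  exact (slant a b ×ˢ (Finset.range (2 * b + 1) ×ˢ Finset.range (a + 1))).image
    (fun q => q.1 ∪ optv 0 q.2.1 ∪ optv q.2.2 0)

lemma card_cand (a b : ℕ) (ha : 1 ≤ a) (hb : 1 ≤ b) :
    ((cand a b).card : ℝ) ≤ Real.exp (5 * lam a b) * ((2 * b + 1) * (a + 1)) := by
  classical
  have h : (cand a b).card ≤ (slant a b).card * ((2 * b + 1) * (a + 1)) := by
    unfold cand
    refine Finset.card_image_le.trans ?_
    simp [Finset.card_product]
  calc ((cand a b).card : ℝ) ≤ ((slant a b).card : ℝ) * ((2 * b + 1) * (a + 1)) := by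
        exact_mod_cast h
    _ ≤ _ := by
        apply mul_le_mul_of_nonneg_right (card_slant a b ha hb); positivity

lemma det2_self (d : Fin 2 → ℤ) : det2 d d = 0 := by unfold det2; ring

lemma steps_nodup {L : List (Fin 2 → ℤ)} (h : L.Pairwise (fun d e => det2 d e < 0)) :
    L.Nodup := by
  refine h.imp ?_
  rintro d e h rfl
  rw [det2_self] at h; exact lt_irrefl _ h

lemma steps_unique {L L' : List (Fin 2 → ℤ)} (h : L.Pairwise (fun d e => det2 d e < 0))
    (h' : L'.Pairwise (fun d e => det2 d e < 0)) (e : L.toFinset = L'.toFinset) : L = L' := by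
  refine List.Perm.eq_of_pairwise ?_ h h'
    (List.perm_of_nodup_nodup_toFinset_eq (steps_nodup h) (steps_nodup h') e)
  intro d e _ _ h1 h2
  rw [det2_antisymm] at h2; omega

lemma steps_mem_cand (L : List (Fin 2 → ℤ)) (a b : ℕ) (ha : 1 ≤ a) (hb : 1 ≤ b)
    (hpos : ∀ d ∈ L, LPos d) (hp : L.Pairwise (fun d e => det2 d e < 0))
    (h0 : (L.map (fun d => d 0)).sum ≤ a) (h1 : (L.map (fun d => |d 1|)).sum ≤ 2 * b) :
    L.toFinset ∈ cand a b := by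
  classical
  have hnd := steps_nodup hp
  set D := L.toFinset with hD
  have hposD : ∀ d ∈ D, LPos d := fun d hd => hpos d (List.mem_toFinset.1 hd)
  have hd0 : ∀ d ∈ D, 0 ≤ d 0 := by
    intro d hd; have := hposD d hd; unfold LPos at this; omega
  have s0 : ∑ d ∈ D, d 0 ≤ a := by rw [hD, List.sum_toFinset _ hnd]; exact h0
  have s1 : ∑ d ∈ D, |d 1| ≤ 2 * b := by rw [hD, List.sum_toFinset _ hnd]; exact h1
  have b0 : ∀ d ∈ D, d 0 ≤ a := fun d hd =>
    (Finset.single_le_sum (f := fun d : Fin 2 → ℤ => d 0) hd0 hd).trans s0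
  have b1 : ∀ d ∈ D, |d 1| ≤ 2 * b := fun d hd =>
    (Finset.single_le_sum (f := fun d : Fin 2 → ℤ => |d 1|) (fun _ _ => abs_nonneg _) hd).trans s1
  have hne : ∀ d ∈ D, ∀ e ∈ D, det2 d e = 0 → d = e := by
    intro d hd e he h
    by_contra hc
    have := hp.imp (S := fun d e => det2 d e ≠ 0) (fun h => ne_of_lt h)
    have hsym : Std.Symm (fun d e : Fin 2 → ℤ => det2 d e ≠ 0) := ⟨by
      intro d e h1 h2; apply h1; rw [det2_antisymm, h2]; rfl⟩
    exact this.forall (List.mem_toFinset.1 hd) (List.mem_toFinset.1 he) hc h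
  set D0 := D.filter (fun d => d 0 ≠ 0 ∧ d 1 ≠ 0) with hD0
  have hv : ∃ y : ℕ, y < 2 * b + 1 ∧ D.filter (fun d => d 0 = 0) = optv 0 y := by
    by_cases h : ∃ d ∈ D, d 0 = 0
    · obtain ⟨d, hd, hz⟩ := h
      have hp := hposD d hd
      have hb1 := abs_le.1 (b1 d hd)
      have hy : 0 < d 1 := by unfold LPos at hp; omega
      refine ⟨(d 1).toNat, by omega, ?_⟩
      have hdd : ![((0 : ℕ) : ℤ), ((d 1).toNat : ℤ)] = d := by
        ext i; fin_cases i
        · simp [hz]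
        · simp; omega
      rw [optv, if_neg (by omega), hdd]
      ext e
      simp only [Finset.mem_filter, Finset.mem_singleton]
      constructor
      · rintro ⟨he, hez⟩
        exact hne e he d hd (by unfold det2; rw [hz, hez]; ring)
      · rintro rfl; exact ⟨hd, hz⟩
    · push Not at h
      refine ⟨0, by omega, ?_⟩
      rw [optv, if_pos (by simp), Finset.filter_eq_empty_iff]
      exact fun d hd => h d hd
  have hh : ∃ x : ℕ, x < a + 1 ∧ D.filter (fun d => d 1 = 0) = optv x 0 := by
    by_cases h : ∃ d ∈ D, d 1 = 0
    · obtain ⟨d, hd, hz⟩ := h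
      have hp := hposD d hd
      have hb0 := b0 d hd
      have hy : 0 < d 0 := by unfold LPos at hp; omega
      refine ⟨(d 0).toNat, by omega, ?_⟩
      have hdd : ![((d 0).toNat : ℤ), ((0 : ℕ) : ℤ)] = d := by
        ext i; fin_cases i
        · simp; omega
        · simp [hz]
      rw [optv, if_neg (by omega), hdd]
      ext e
      simp only [Finset.mem_filter, Finset.mem_singleton]
      constructor
      · rintro ⟨he, hez⟩
        exact hne e he d hd (by unfold det2; rw [hz, hez]; ring)
      · rintro rfl; exact ⟨hd, hz⟩
    · push Not at h
      refine ⟨0, by omega, ?_⟩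
      rw [optv, if_pos (by simp), Finset.filter_eq_empty_iff]
      exact fun d hd => h d hd
  obtain ⟨y, hy, ey⟩ := hv
  obtain ⟨x, hx, ex⟩ := hh
  unfold cand
  rw [Finset.mem_image]
  refine ⟨(D0, y, x), ?_, ?_⟩
  · simp only [Finset.mem_product, Finset.mem_range]
    refine ⟨?_, hy, hx⟩
    unfold slant
    rw [Finset.mem_filter, Finset.mem_powerset]
    constructor
    · intro d hd
      obtain ⟨hd, n0, n1⟩ := Finset.mem_filter.1 hd
      exact mem_boxE a b d (lt_of_le_of_ne (hd0 d hd) (Ne.symm n0)) (b0 d hd) n1 (b1 d hd)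
    · have hl := lam_pos ha hb
      have ha' : (0 : ℝ) < a := by exact_mod_cast ha
      have hb' : (0 : ℝ) < b := by exact_mod_cast hb
      have s0' : ∑ d ∈ D0, (d 0 : ℝ) ≤ a := by
        have : ∑ d ∈ D0, d 0 ≤ a := (Finset.sum_le_sum_of_subset_of_nonneg
          (Finset.filter_subset _ _) (fun d hd _ => hd0 d hd)).trans s0
        exact_mod_cast this
      have s1' : ∑ d ∈ D0, |(d 1 : ℝ)| ≤ 2 * b := by
        have : ∑ d ∈ D0, |d 1| ≤ 2 * b := (Finset.sum_le_sum_of_subset_of_nonneg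
          (Finset.filter_subset _ _) (fun d hd _ => abs_nonneg _)).trans s1
        exact_mod_cast this
      rw [Finset.sum_add_distrib, ← Finset.mul_sum, ← Finset.mul_sum]
      have t0 := mul_le_mul_of_nonneg_left s0' (show 0 ≤ lam a b / a by positivity)
      have t1 := mul_le_mul_of_nonneg_left s1' (show 0 ≤ lam a b / b by positivity)
      have u0 : lam a b / a * a = lam a b := by field_simp
      have u1 : lam a b / b * (2 * b) = 2 * lam a b := by field_simp
      linarith
  · simp only
    rw [← ey, ← ex]
    ext d
    simp only [hD0, Finset.mem_union, Finset.mem_filter]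
    tauto

/-- All candidate step sets. -/
def allCand (m : ℕ) : Finset (Finset (Fin 2 → ℤ)) := by
  classical
  exact ((Finset.range (4 * m + 1) ×ˢ Finset.range (4 * m + 1)).filter
    (fun q => 1 ≤ q.1 ∧ 1 ≤ q.2 ∧ q.1 * q.2 ≤ 4 * m)).biUnion (fun q => cand q.1 q.2)

lemma card_allCand (m : ℕ) (hm : 1 ≤ m) :
    ((allCand m).card : ℝ) ≤ Real.exp (34 * (m : ℝ) ^ ((1 : ℝ) / 3)) := by
  classical
  set μ := (m : ℝ) ^ ((1 : ℝ) / 3) with hμ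
  have hm1 : (1 : ℝ) ≤ m := by exact_mod_cast hm
  have hμ3 : μ ^ 3 = m := cbrt_cube (by positivity)
  have hμ1 : 1 ≤ μ := Real.one_le_rpow hm1 (by norm_num)
  have h10 : 10 * (m : ℝ) ≤ Real.exp (6 * μ) := by
    have e1 : (10 : ℝ) ≤ Real.exp (3 * μ) := by
      have h := Real.exp_one_gt_d9
      have h2 : (10 : ℝ) ≤ Real.exp 1 ^ 3 := by
        have := pow_le_pow_left₀ (by norm_num) h.le 3
        refine le_trans ?_ this; norm_num
      have h3 : Real.exp 1 ^ 3 = Real.exp 3 := by rw [← Real.exp_nat_mul]; norm_num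
      rw [h3] at h2
      exact h2.trans (Real.exp_le_exp.2 (by linarith))
    have e2 : (m : ℝ) ≤ Real.exp (3 * μ) := by
      have h := Real.add_one_le_exp μ
      have h2 : Real.exp (3 * μ) = Real.exp μ ^ 3 := by rw [← Real.exp_nat_mul]; norm_num
      rw [h2, ← hμ3]
      exact pow_le_pow_left₀ (by linarith) (by linarith) 3
    have e3 : Real.exp (6 * μ) = Real.exp (3 * μ) * Real.exp (3 * μ) := by
      rw [← Real.exp_add]; congr 1; ring
    rw [e3]
    exact mul_le_mul e1 e2 (by positivity) (Real.exp_pos _).le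
  have hab : ∀ a b : ℕ, 1 ≤ a → 1 ≤ b → a * b ≤ 4 * m →
      ((cand a b).card : ℝ) ≤ Real.exp (10 * μ) * (10 * m) ^ 2 := by
    intro a b ha hb h
    have hh : (a : ℝ) * b ≤ 4 * m := by exact_mod_cast h
    have ha' : (1 : ℝ) ≤ a := by exact_mod_cast ha
    have hb' : (1 : ℝ) ≤ b := by exact_mod_cast hb
    refine (card_cand a b ha hb).trans ?_
    apply mul_le_mul _ _ (by positivity) (Real.exp_pos _).le
    · apply Real.exp_le_exp.2
      have h3 : lam a b ^ 3 = a * b := cbrt_cube (by positivity)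
      have : lam a b ≤ 2 * μ := by
        apply le_of_pow_le_pow_left₀ (n := 3) (by norm_num) (by positivity)
        rw [h3, mul_pow, hμ3]; linarith
      linarith
    · nlinarith
  set n := ⌊Real.exp (10 * μ) * (10 * (m : ℝ)) ^ 2⌋₊ with hn
  have h1 : (allCand m).card ≤ ((4 * m + 1) * (4 * m + 1)) * n := by
    unfold allCand
    refine (Finset.card_biUnion_le_card_mul _ _ n ?_).trans ?_
    · intro q hq
      obtain ⟨_, q1, q2, q3⟩ := Finset.mem_filter.1 hq
      exact Nat.le_floor (hab q.1 q.2 q1 q2 q3)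
    · apply Nat.mul_le_mul_right
      refine (Finset.card_filter_le _ _).trans ?_
      simp [Finset.card_product]
  have h2 : (n : ℝ) ≤ Real.exp (10 * μ) * (10 * (m : ℝ)) ^ 2 := Nat.floor_le (by positivity)
  have h1' : ((allCand m).card : ℝ) ≤ ((4 * m + 1) * (4 * m + 1)) * n := by exact_mod_cast h1
  calc ((allCand m).card : ℝ) ≤ ((4 * m + 1) * (4 * m + 1)) * n := h1'
    _ ≤ (10 * m) ^ 2 * (Real.exp (10 * μ) * (10 * (m : ℝ)) ^ 2) := by
        apply mul_le_mul _ h2 (by positivity) (by positivity)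
        nlinarith
    _ = (10 * (m : ℝ)) ^ 4 * Real.exp (10 * μ) := by ring
    _ ≤ Real.exp (6 * μ) ^ 4 * Real.exp (10 * μ) := by
        apply mul_le_mul_of_nonneg_right _ (Real.exp_pos _).le
        exact pow_le_pow_left₀ (by positivity) h10 4
    _ = Real.exp (34 * μ) := by
        rw [← Real.exp_nat_mul, ← Real.exp_add]; congr 1; push_cast; ring

lemma upper_count (m : ℕ) (hm : 1 ≤ m) :
    Finite (ClassesType 2 (fun P => IsCentrallySymmetric 2 P ∧
        volume P = ENNReal.ofReal ((m : ℝ) / 2))) ∧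
      (Nat.card (ClassesType 2 (fun P => IsCentrallySymmetric 2 P ∧
          volume P = ENNReal.ofReal ((m : ℝ) / 2))) : ℝ) ≤
        Real.exp (34 * (m : ℝ) ^ ((1 : ℝ) / 3)) := by
  classical
  have key : ∀ c : ClassesType 2 (fun P => IsCentrallySymmetric 2 P ∧
        volume P = ENNReal.ofReal ((m : ℝ) / 2)), ∃ D : {D // D ∈ allCand m},
      ∃ P : {P : Set (Fin 2 → ℝ) // IsConvexLatticePolytope 2 P ∧ IsFullDim 2 P ∧
        (IsCentrallySymmetric 2 P ∧ volume P = ENNReal.ofReal ((m : ℝ) / 2))},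
        c = Quot.mk _ P ∧
      ∃ p L, L.Pairwise (fun d e => det2 d e < 0) ∧ L.toFinset = D.1 ∧
        LatticeEquiv 2 P.1 (FL p L) := by
    intro c
    obtain ⟨P, rfl⟩ := Quot.exists_rep c
    obtain ⟨S, w, a, b, ⟨g1, g2, g3, g4, g5⟩, ha, hb, hab, hbd⟩ :=
      box_rep P.1 P.2.1 P.2.2.2.1 m hm P.2.2.2.2
    obtain ⟨p, L, l1, l2, l3, l4, l5⟩ := symm_polygon S g1 w g2 a b g5 hbd
    refine ⟨⟨L.toFinset, ?_⟩, P, rfl, p, L, l2, rfl, ?_⟩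
    · unfold allCand
      rw [Finset.mem_biUnion]
      refine ⟨(a, b), ?_, steps_mem_cand L a b ha hb l1 l2 l4 l5⟩
      simp only [Finset.mem_filter, Finset.mem_product, Finset.mem_range]
      refine ⟨⟨?_, ?_⟩, ha, hb, hab⟩ <;> nlinarith
    · rw [← l3]; exact g3
  choose f hf using key
  have hinj : Function.Injective f := by
    intro c c' h
    obtain ⟨P, e, p, L, h1, h2, h3⟩ := hf c
    obtain ⟨P', e', p', L', h1', h2', h3'⟩ := hf c'
    rw [e, e']
    refine (classes_eq_iff P P').2 ?_
    have : L = L' := steps_unique h1 h1' (by rw [h2, h2', h])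
    subst this
    exact h3.trans' ((FL_equiv p p' L).trans' h3'.symm')
  refine ⟨Finite.of_injective f hinj, ?_⟩
  refine le_trans ?_ (card_allCand m hm)
  have := Nat.card_le_card_of_injective f hinj
  rw [Nat.card_eq_fintype_card (α := {D // D ∈ allCand m}), Fintype.card_coe] at this
  exact_mod_cast this

lemma growth : ∃ M : ℕ, ∀ m : ℕ, M ≤ m →
    (18 : ℝ) ≤ (m : ℝ) ^ ((1 : ℝ) / 3) ∧
    Real.exp (1 / 100 * (m : ℝ) ^ ((1 : ℝ) / 3)) * ((m : ℝ) + 1) ^ 6 ≤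
      Real.exp ((m : ℝ) ^ ((1 : ℝ) / 3) / 12 - 3 / 2) := by
  have h1 := (isLittleO_pow_exp_pos_mul_atTop (b := 1 / 20) 18 (by norm_num)).def
    (c := Real.exp (-(3 / 2)) / 64) (by positivity)
  have ht : Filter.Tendsto (fun m : ℕ => (m : ℝ) ^ ((1 : ℝ) / 3)) Filter.atTop Filter.atTop :=
    (tendsto_rpow_atTop (by norm_num)).comp tendsto_natCast_atTop_atTop
  have h2 := ht.eventually (h1.and (Filter.eventually_ge_atTop (18 : ℝ)))
  obtain ⟨M, hM⟩ := Filter.eventually_atTop.1 h2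
  refine ⟨M, fun m hm => ?_⟩
  obtain ⟨a1, a2⟩ := hM m hm
  refine ⟨a2, ?_⟩
  have hμ3 := cbrt_cube (x := (m : ℝ)) (by positivity)
  set μ := (m : ℝ) ^ ((1 : ℝ) / 3)
  have hp : 0 < μ := by linarith
  rw [Real.norm_of_nonneg (by positivity), Real.norm_of_nonneg (Real.exp_pos _).le] at a1
  have b1 : ((m : ℝ) + 1) ^ 6 ≤ 64 * μ ^ 18 := by
    have : (m : ℝ) + 1 ≤ 2 * μ ^ 3 := by
      have : 1 ≤ μ ^ 3 := one_le_pow₀ (by linarith)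
      linarith
    calc ((m : ℝ) + 1) ^ 6 ≤ (2 * μ ^ 3) ^ 6 := pow_le_pow_left₀ (by positivity) this 6
      _ = _ := by ring
  have b2 : ((m : ℝ) + 1) ^ 6 ≤ Real.exp (-(3 / 2)) * Real.exp (1 / 20 * μ) := by
    refine b1.trans ?_
    calc 64 * μ ^ 18 ≤ 64 * (Real.exp (-(3 / 2)) / 64 * Real.exp (1 / 20 * μ)) := by gcongr
      _ = _ := by ring
  refine (mul_le_mul_of_nonneg_left b2 (Real.exp_pos _).le).trans ?_
  rw [← Real.exp_add, ← Real.exp_add]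
  apply Real.exp_le_exp.2
  linarith

/-- **Theorem 1.** For all sufficiently large even `m`, the number `v*(2,m)` of
equivalence classes of centrally symmetric convex lattice polygons of area `m/2`
is finite and satisfies `exp(c₁ m^{1/3}) ≤ v*(2,m) ≤ exp(c₂ m^{1/3})`. -/
theorem vstar_two_bounds :
    ∃ c₁ c₂ : ℝ, 0 < c₁ ∧ 0 < c₂ ∧ ∃ M : ℕ, ∀ m : ℕ, M ≤ m → Even m →
      Finite (ClassesType 2 (fun P => IsCentrallySymmetric 2 P ∧
        volume P = ENNReal.ofReal ((m : ℝ) / 2))) ∧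
      Real.exp (c₁ * (m : ℝ) ^ ((1 : ℝ) / 3)) ≤
        (Nat.card (ClassesType 2 (fun P => IsCentrallySymmetric 2 P ∧
          volume P = ENNReal.ofReal ((m : ℝ) / 2))) : ℝ) ∧
      (Nat.card (ClassesType 2 (fun P => IsCentrallySymmetric 2 P ∧
          volume P = ENNReal.ofReal ((m : ℝ) / 2))) : ℝ) ≤
        Real.exp (c₂ * (m : ℝ) ^ ((1 : ℝ) / 3)) := by
  obtain ⟨M, hM⟩ := growth
  refine ⟨1 / 100, 34, by norm_num, by norm_num, M + 1, fun m hm he => ?_⟩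
  obtain ⟨hfin, hub⟩ := upper_count m (by omega)
  refine ⟨hfin, ?_, hub⟩
  obtain ⟨g1, g2⟩ := hM m (by omega)
  have hμ3 := cbrt_cube (x := (m : ℝ)) (by positivity)
  set μ := (m : ℝ) ^ ((1 : ℝ) / 3)
  obtain ⟨n, hn⟩ := he
  set k := ⌊μ / 6⌋₊ with hk
  have k1 : (k : ℝ) ≤ μ / 6 := Nat.floor_le (by linarith)
  have k2 : μ / 6 < k + 1 := Nat.lt_floor_add_one _
  have k3 : 3 ≤ k := Nat.le_floor (by push_cast; linarith)
  have hnr : (m : ℝ) = n + n := by exact_mod_cast hn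
  have k4 : 100 * k ^ 3 ≤ n := by
    have : (k : ℝ) ^ 3 ≤ (μ / 6) ^ 3 := pow_le_pow_left₀ (by positivity) k1 3
    have h2 : (μ / 6) ^ 3 = (n + n) / 216 := by rw [div_pow, hμ3, hnr]; norm_num
    have h3 : (100 : ℝ) * k ^ 3 ≤ n := by
      rw [h2] at this
      have : (0 : ℝ) ≤ n := by positivity
      linarith
    exact_mod_cast h3
  have hl := lower_count n k m (by omega) k3 k4 hfin
  set N := Nat.card (ClassesType 2 (fun P => IsCentrallySymmetric 2 P ∧
          volume P = ENNReal.ofReal ((m : ℝ) / 2)))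
  have hl' : (2 : ℝ) ^ (k - 2) ≤ ((m : ℝ) + 1) ^ 6 * N := by
    have e : (m : ℝ) + 1 = 2 * n + 1 := by rw [hnr]; ring
    rw [e]; exact_mod_cast hl
  have h2 : Real.exp (μ / 12 - 3 / 2) ≤ (2 : ℝ) ^ (k - 2) := by
    have e1 : Real.exp (1 / 2) ≤ 2 := by
      rw [← Real.le_log_iff_exp_le (by norm_num)]
      have := Real.log_two_gt_d9; linarith
    calc Real.exp (μ / 12 - 3 / 2) ≤ Real.exp ((k - 2 : ℕ) * (1 / 2)) := by
          apply Real.exp_le_exp.2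
          rw [Nat.cast_sub (by omega)]; push_cast; linarith
      _ = Real.exp (1 / 2) ^ (k - 2) := Real.exp_nat_mul _ _
      _ ≤ _ := pow_le_pow_left₀ (Real.exp_pos _).le e1 _
  have h3 := (g2.trans h2).trans hl'
  rw [mul_comm (((m : ℝ) + 1) ^ 6)] at h3
  exact le_of_mul_le_mul_right h3 (by positivity)


end
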